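/- arXiv:0709.1297 — 2 statements merged into one kernel-verified Lean document; each statement's English description precedes it below -/
import Mathlib

section
/- Let K be a field with char K = p > 0, and let 1 → H → G̃ → G → 1 be a group extension of finite groups, where H is an abelian p-group contained in the center of G̃. Then there exists a K-embedding ι : K(G) → K(G̃) such that K(G̃) is rational (purely transcendental) over the subfield ι(K(G)). -/
set_option synthInstance.maxHeartbeats 1000000
set_option maxHeartbeats 1000000

noncomputable section

/-- The rational function field `K(x(g) : g ∈ G)` in variables indexed by `G`. -/
abbrev NoetherBigField (K : Type*) [Field K] (G : Type*) : Type _ :=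
  FractionRing (MvPolynomial G K)

/-- The `K`-automorphism of `K(x(g) : g ∈ G)` induced by `h · x(g) = x(hg)`. -/
def noetherAut (K : Type*) [Field K] (G : Type*) [Group G] (h : G) :
    NoetherBigField K G ≃ₐ[K] NoetherBigField K G :=
  IsFractionRing.algEquivOfAlgEquiv (MvPolynomial.renameEquiv K (Equiv.mulLeft h))

/-- The fixed field `K(G) = K(x(g) : g ∈ G)^G`, as a subfield. -/
def noetherSubfield (K : Type*) [Field K] (G : Type*) [Group G] :
    Subfield (NoetherBigField K G) where
  carrier := {x | ∀ h : G, noetherAut K G h x = x}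
  mul_mem' := by intro a b ha hb h; rw [map_mul, ha h, hb h]
  one_mem' := by intro h; rw [map_one]
  add_mem' := by intro a b ha hb h; rw [map_add, ha h, hb h]
  zero_mem' := by intro h; rw [map_zero]
  neg_mem' := by intro a ha h; rw [map_neg, ha h]
  inv_mem' := by intro a ha h; rw [map_inv₀, ha h]

/-- Noether's fixed field `K(G) = K(x(g) : g ∈ G)^G`. -/
def NoetherField (K : Type*) [Field K] (G : Type*) [Group G] : Type _ :=
  noetherSubfield K G

instance (K : Type*) [Field K] (G : Type*) [Group G] : Field (NoetherField K G) :=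
  inferInstanceAs (Field (noetherSubfield K G))

theorem algebraMap_mem_noetherSubfield (K : Type*) [Field K] (G : Type*) [Group G] (c : K) :
    algebraMap K (NoetherBigField K G) c ∈ noetherSubfield K G := by
  intro h
  exact AlgEquiv.commutes _ c

instance (K : Type*) [Field K] (G : Type*) [Group G] : Algebra K (NoetherField K G) :=
  RingHom.toAlgebra <|
    ((algebraMap K (NoetherBigField K G)).codRestrict (noetherSubfield K G).toSubring
      (algebraMap_mem_noetherSubfield K G))

/-- An extension `L/F` is rational (purely transcendental) if `L` is `F`-isomorphic to a
rational function field `F(t₁, …, tₙ)` over `F` in finitely many variables. -/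
def IsRationalExtension (F L : Type*) [Field F] [Field L] [Algebra F L] : Prop :=
  ∃ n : ℕ, Nonempty (L ≃ₐ[F] FractionRing (MvPolynomial (Fin n) F))

/-- An extension `L/F` is stably rational if the rational function field `L(y₁, …, y_r)`
is rational over `F` for some finite number `r` of indeterminates. -/
def IsStablyRationalExtension (F L : Type*) [Field F] [Field L] [Algebra F L] : Prop :=
  ∃ r : ℕ, IsRationalExtension F (FractionRing (MvPolynomial (Fin r) L))

open scoped IntermediateField

theorem rat_of_gens (F L : Type*) [Field F] [Field L] [Algebra F L] (s : Finset L)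
    (hs : IntermediateField.adjoin F (s : Set L) = ⊤)
    (h : (s.card : Cardinal) ≤ Algebra.trdeg F L) : IsRationalExtension F L := by
  classical
  let x : Fin s.card → L := fun i => (s.equivFin.symm i : L)
  have hr : Set.range x = (s : Set L) := by
    ext z
    constructor
    · rintro ⟨i, rfl⟩
      exact (s.equivFin.symm i).2
    · intro hz
      exact ⟨s.equivFin ⟨z, hz⟩, by simp [x]⟩
  have halg : Algebra.IsAlgebraic (Algebra.adjoin F (Set.range x)) L := by
    rw [← IntermediateField.isAlgebraic_adjoin_iff_top, hr, hs]
    refine ⟨fun z => ?_⟩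
    exact isAlgebraic_algebraMap (R := (⊤ : IntermediateField F L)) ⟨z, trivial⟩
  have hb : IsTranscendenceBasis F x := by
    apply Algebra.IsAlgebraic.isTranscendenceBasis_of_lift_le_trdeg_of_finite
    simpa using h
  have e := hb.1.aevalEquivField
  rw [hr, hs] at e
  exact ⟨s.card, ⟨(e.trans IntermediateField.topEquiv).symm⟩⟩

theorem span_traces (M Gt : Type*) [Field M] [Group Gt] [Fintype Gt] [MulSemiringAction Gt M]
    (P : Subfield M) (hP : ∀ σ : Gt, ∀ a ∈ P, σ • a ∈ P)
    (hf : ∀ σ : Gt, (∀ a ∈ P, σ • a = a) → σ = 1) (x : M) (τ : Gt) :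
    τ • x ∈ Submodule.span P {t : M | ∃ a ∈ P, t = ∑ σ : Gt, (σ • a) * (σ • x)} := by
  classical
  let v : P → (Gt → P) := fun a σ => ⟨σ • (a : M), hP σ a a.2⟩
  have htop : Submodule.span P (Set.range v) = ⊤ := by
    by_contra hne
    obtain ⟨f, hf0, hker⟩ := Submodule.exists_le_ker_of_lt_top _ (lt_top_iff_ne_top.mpr hne)
    apply hf0
    let χ : Gt → (P →* M) := fun σ =>
      { toFun := fun a => σ • (a : M), map_one' := by simp, map_mul' := by intros; simp }
    have hχ : Function.Injective χ := by
      intro σ τ h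
      have : τ⁻¹ * σ = 1 := by
        apply hf
        intro a ha
        have := DFunLike.congr_fun h ⟨a, ha⟩
        change σ • a = τ • a at this
        rw [mul_smul, this, inv_smul_smul]
      exact (inv_mul_eq_one.mp this).symm
    have hli := (linearIndependent_monoidHom P M).comp χ hχ
    rw [Fintype.linearIndependent_iff] at hli
    have hz : ∀ σ, ((f (Pi.single σ 1) : P) : M) = 0 := by
      apply hli
      ext a
      have h1 : f (v a) = 0 := hker (Submodule.subset_span ⟨a, rfl⟩)
      have h2 : v a = ∑ σ, v a σ • (Pi.single σ 1 : Gt → P) := by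
        exact pi_eq_sum_univ' (v a) |>.trans (by
          congr 1)
      rw [h2, map_sum] at h1
      have h3 := congrArg (fun z : P => (z : M)) h1
      simp only [map_smul, smul_eq_mul] at h3
      push_cast at h3
      simpa [χ, v, mul_comm] using h3
    apply LinearMap.pi_ext'
    intro σ
    ext
    simpa using hz σ
  let Φ : (Gt → P) →ₗ[P] M := Fintype.linearCombination P (fun σ : Gt => σ • x)
  have h1 : Φ (Pi.single τ 1) = τ • x := by
    simp [Φ, Fintype.linearCombination_apply_single]
  rw [← h1]
  have h2 : (Pi.single τ 1 : Gt → P) ∈ Submodule.span P (Set.range v) := htop ▸ trivial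
  have h3 := Submodule.mem_map_of_mem (f := Φ) h2
  rw [Submodule.map_span] at h3
  refine Submodule.span_mono ?_ h3
  rintro _ ⟨_, ⟨a, rfl⟩, rfl⟩
  refine ⟨a, a.2, ?_⟩
  simp [Φ, Fintype.linearCombination_apply, v, Subfield.smul_def]

theorem degree_bound (L M G Gt : Type*) [Field L] [Field M] [Group G] [Group Gt] [Fintype G]
    [Fintype Gt] [MulSemiringAction G L] [MulSemiringAction Gt M] [FaithfulSMul Gt M]
    (j : L →+* M) (E : Subfield M) (hE : ∀ l, (∀ g : G, g • l = l) → j l ∈ E)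
    (hE' : ∀ e ∈ E, ∀ σ : Gt, σ • e = e) (p : ℕ) (hp : p.Prime)
    (hcard : Fintype.card Gt = Fintype.card G * p) (y w : M)
    (hw : w ∈ Subfield.closure ((E : Set M) ∪ Set.range j)) (hy : y ^ p - y = w)
    (htop : Subfield.closure ((E : Set M) ∪ Set.range j ∪ {y}) = ⊤)
    (m : M) (hm : ∀ σ : Gt, σ • m = m) : m ∈ E := by
  obtain ⟨θ, hθ⟩ := Field.exists_primitive_element (FixedPoints.subfield G L) L
  let j0 : FixedPoints.subfield G L →+* E :=
    (j.comp (FixedPoints.subfield G L).subtype).codRestrict E (fun l => hE l l.2)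
  have hint := Algebra.IsIntegral.isIntegral (R := FixedPoints.subfield G L) θ
  have hd : (minpoly (FixedPoints.subfield G L) θ).natDegree ≤ Fintype.card G := by
    rw [← IntermediateField.adjoin.finrank hint, hθ, IntermediateField.finrank_top']
    exact FixedPoints.finrank_le_card G L
  let f := (minpoly (FixedPoints.subfield G L) θ).map j0
  have hfm : f.Monic := (minpoly.monic hint).map _
  have hfr : Polynomial.aeval (j θ) f = 0 := by
    have h1 : Polynomial.eval₂ (j.comp (algebraMap (FixedPoints.subfield G L) L)) (j θ)
        (minpoly (FixedPoints.subfield G L) θ) = 0 := by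
      rw [← Polynomial.hom_eval₂, ← Polynomial.aeval_def, minpoly.aeval, map_zero]
    rw [Polynomial.aeval_def, Polynomial.eval₂_map]
    exact h1
  have hθi : IsIntegral E (j θ) := ⟨f, hfm, hfr⟩
  let A : IntermediateField E M := E⟮j θ⟯
  have hAfd : FiniteDimensional E A := IntermediateField.adjoin.finiteDimensional hθi
  have hA : Module.finrank E A ≤ Fintype.card G := by
    rw [IntermediateField.adjoin.finrank hθi]
    refine le_trans (Polynomial.natDegree_le_of_dvd (minpoly.dvd E _ hfr) hfm.ne_zero) ?_
    exact (Polynomial.natDegree_map_le).trans hd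
  have hjA : ∀ l, j l ∈ A := by
    let B : IntermediateField (FixedPoints.subfield G L) L :=
      { A.toSubfield.comap j with
        algebraMap_mem' := fun r => A.algebraMap_mem (j0 r) }
    have hB : B = ⊤ := by
      rw [eq_top_iff, ← hθ, IntermediateField.adjoin_simple_le_iff]
      exact IntermediateField.mem_adjoin_simple_self E (j θ)
    intro l
    have : l ∈ B := hB ▸ trivial
    exact this
  have hcl : Subfield.closure ((E : Set M) ∪ Set.range j) ≤ A.toSubfield := by
    rw [Subfield.closure_le]
    rintro _ (h | ⟨l, rfl⟩)
    · exact A.algebraMap_mem ⟨_, h⟩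
    · exact hjA l
  let q : Polynomial A := Polynomial.X ^ p - Polynomial.X - Polynomial.C ⟨w, hcl hw⟩
  have hqd : q.natDegree = p ∧ q.Monic := by
    have h1 : q = Polynomial.X ^ p - (Polynomial.X + Polynomial.C ⟨w, hcl hw⟩) := by
      simp only [q]; ring
    have h2 : (Polynomial.X + Polynomial.C (⟨w, hcl hw⟩ : A)).degree < (p : WithBot ℕ) := by
      rw [Polynomial.degree_X_add_C]
      exact_mod_cast hp.one_lt
    rw [h1]
    exact ⟨by rw [Polynomial.natDegree_sub_eq_left_of_natDegree_lt] <;> simp [hp.one_lt],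
      Polynomial.monic_X_pow_sub h2⟩
  have hqr : Polynomial.aeval y q = 0 := by
    simp only [q, map_sub, map_pow, Polynomial.aeval_X, Polynomial.aeval_C]
    rw [hy]
    exact sub_self w
  have hyi : IsIntegral A y := ⟨q, hqd.2, hqr⟩
  have hAy : A⟮y⟯ = ⊤ := by
    have : (⊤ : Subfield M) ≤ A⟮y⟯.toSubfield := by
      rw [← htop, Subfield.closure_le]
      rintro z (hz | hz)
      · exact A⟮y⟯.algebraMap_mem ⟨z, hcl (Subfield.subset_closure hz)⟩
      · rw [Set.mem_singleton_iff.mp hz]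
        exact IntermediateField.mem_adjoin_simple_self A y
    rw [eq_top_iff]
    intro z _
    exact this (Subfield.mem_top z)
  have hAMfd : FiniteDimensional A M := by
    have := IntermediateField.adjoin.finiteDimensional hyi
    rw [hAy] at this
    exact Module.Finite.equiv (IntermediateField.topEquiv (F := A) (E := M)).toLinearEquiv
  have hAM : Module.finrank A M ≤ p := by
    rw [← IntermediateField.finrank_top' (F := A) (E := M), ← hAy,
      IntermediateField.adjoin.finrank hyi, ← hqd.1]
    exact Polynomial.natDegree_le_of_dvd (minpoly.dvd A _ hqr) hqd.2.ne_zero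
  have hEM : Module.finrank E M ≤ Fintype.card Gt := by
    rw [← Module.finrank_mul_finrank E A M, hcard]
    exact Nat.mul_le_mul hA hAM
  have hEMfd : FiniteDimensional E M := Module.Finite.trans A M
  let Fx : IntermediateField E M :=
    { FixedPoints.subfield Gt M with
      algebraMap_mem' := fun e σ => hE' e e.2 σ }
  have hFx : Module.finrank Fx M = Fintype.card Gt := FixedPoints.finrank_eq_card Gt M
  have hb : Fx = ⊥ := by
    rw [← IntermediateField.finrank_eq_one_iff]
    have h1 := Module.finrank_mul_finrank E Fx M
    rw [hFx] at h1
    have hpos : 0 < Fintype.card Gt := Fintype.card_pos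
    have h2 : 0 < Module.finrank E Fx := Module.finrank_pos
    have h3 : Module.finrank E Fx * Fintype.card Gt ≤ 1 * Fintype.card Gt := by omega
    have := Nat.le_of_mul_le_mul_right h3 hpos
    omega
  have hmF : m ∈ Fx := fun σ => hm σ
  rw [hb, IntermediateField.mem_bot] at hmF
  obtain ⟨e, rfl⟩ := hmF
  exact e.2

theorem step_abstract (L M G Gt : Type*) [Field L] [Field M] [Group G] [Group Gt] [Fintype G]
    [Fintype Gt] [MulSemiringAction G L] [MulSemiringAction Gt M] [FaithfulSMul Gt M]
    (π : Gt →* G) (j : L →+* M) (hj : ∀ (σ : Gt) (l : L), σ • j l = j (π σ • l))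
    (x0 y z : M) (p : ℕ) (hp : p.Prime) (hcard : Fintype.card Gt = Fintype.card G * p)
    (hgen : Subfield.closure (Set.range j ∪ Set.range (fun σ : Gt => σ • x0)) = ⊤)
    (hb : ∀ σ : Gt, σ • y - y ∈ Set.range j)
    (hf : ∀ σ : Gt, (∀ l, σ • j l = j l) → σ • y = y → σ = 1)
    (hz : ∀ σ : Gt, σ • z = z) (hyz : y ^ p - y - z ∈ Set.range j)
    (T : Finset Gt)
    (hT : ∀ σ : Gt, σ • x0 ∈ Submodule.span (Subfield.closure (Set.range j ∪ {y}))
      (insert (1 : M) ((fun σ : Gt => σ • x0) '' (T : Set Gt)))) :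
    ∃ s : Finset M, s.card ≤ T.card + 1 ∧ (∀ t ∈ s, ∀ σ : Gt, σ • t = t) ∧
      ∀ m : M, (∀ σ : Gt, σ • m = m) →
        m ∈ Subfield.closure (j '' {l | ∀ g : G, g • l = l} ∪ (s : Set M)) := by
  classical
  set P := Subfield.closure (Set.range j ∪ {y}) with hPdef
  have hjP : ∀ l, j l ∈ P := fun l => Subfield.subset_closure (Or.inl ⟨l, rfl⟩)
  have hyP : y ∈ P := Subfield.subset_closure (Or.inr rfl)
  have hP : ∀ σ : Gt, ∀ a ∈ P, σ • a ∈ P := by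
    intro σ
    have : P ≤ P.comap (MulSemiringAction.toRingHom Gt M σ) := by
      rw [hPdef, Subfield.closure_le]
      rintro _ (⟨l, rfl⟩ | h)
      · change σ • j l ∈ P
        rw [hj]
        exact hjP _
      · rw [Set.mem_singleton_iff.mp h]
        change σ • y ∈ P
        obtain ⟨l, hl⟩ := hb σ
        have : σ • y = j l + y := by rw [hl]; ring
        rw [this]
        exact P.add_mem (hjP l) hyP
    exact fun a ha => this ha
  have hPf : ∀ σ : Gt, (∀ a ∈ P, σ • a = a) → σ = 1 := fun σ h =>
    hf σ (fun l => h _ (hjP l)) (h _ hyP)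
  set tr : Set M := {t : M | ∃ a ∈ P, t = ∑ σ : Gt, (σ • a) * (σ • x0)} with htr
  have hspan := span_traces M Gt P hP hPf x0
  have h1li : LinearIndepOn P (id : M → M) {1} := by
    apply LinearIndepOn.singleton
    exact one_ne_zero
  obtain ⟨b, hbt, h1b, hsb, hbli⟩ := exists_linearIndepOn_extension (t := insert 1 tr) h1li
    (by simp)
  let w : Finset M := insert (1 : M) (T.image (fun σ : Gt => σ • x0))
  have hwspan : ∀ σ : Gt, σ • x0 ∈ Submodule.span P (w : Set M) := by
    intro σ
    simpa [w] using hT σ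
  have h1w : (1 : M) ∈ Submodule.span P (w : Set M) := Submodule.subset_span (by simp [w])
  have hbw : b ⊆ Submodule.span P (w : Set M) := by
    intro t ht
    rcases hbt ht with rfl | ⟨a, ha, rfl⟩
    · exact h1w
    · apply Submodule.sum_mem
      intro σ _
      exact Submodule.smul_mem _ (⟨σ • a, hP σ a ha⟩ : P) (hwspan σ)
  have hcb : Cardinal.mk b ≤ (w.card : Cardinal) := by
    have := linearIndependent_le_span' (R := P) (fun i : b => (i : M)) hbli (w : Set M)
      (by simpa using hbw)
    simpa using this
  have hbfin : b.Finite := by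
    rw [← Cardinal.lt_aleph0_iff_set_finite]
    exact hcb.trans_lt (Cardinal.natCast_lt_aleph0)
  let b' := hbfin.toFinset
  have hcb' : b'.card ≤ T.card + 1 := by
    have h1 : Cardinal.mk b = (b'.card : Cardinal) := by
      rw [← Cardinal.mk_coe_finset]
      simp [b']
    rw [h1] at hcb
    have h2 : b'.card ≤ w.card := by exact_mod_cast hcb
    exact h2.trans ((Finset.card_insert_le _ _).trans
      (Nat.add_le_add_right Finset.card_image_le 1))
  have h1b' : (1 : M) ∈ b' := by simpa [b'] using h1b
  have hinv : ∀ t ∈ insert z (b'.erase 1), ∀ σ : Gt, σ • t = t := by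
    intro t ht τ
    rcases Finset.mem_insert.mp ht with rfl | ht
    · exact hz τ
    · rw [Finset.mem_erase] at ht
      have : t ∈ b := by simpa [b'] using ht.2
      rcases hbt this with h | ⟨a, ha, rfl⟩
      · exact absurd h ht.1
      · rw [Finset.smul_sum]
        simp only [smul_mul', smul_smul]
        exact Fintype.sum_equiv (Equiv.mulLeft τ) _ _ (fun σ => rfl)
  refine ⟨insert z (b'.erase 1), ?_, ?_, ?_⟩
  · refine (Finset.card_insert_le _ _).trans ?_
    rw [Finset.card_erase_of_mem h1b']
    have : 0 < b'.card := Finset.card_pos.mpr ⟨1, h1b'⟩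
    omega
  · exact hinv
  · intro m hm
    set E := Subfield.closure (j '' {l | ∀ g : G, g • l = l} ∪
      ((insert z (b'.erase 1) : Finset M) : Set M)) with hEdef
    have hzE : z ∈ E := Subfield.subset_closure (Or.inr (by simp))
    have hbE : ∀ t ∈ b, t ∈ E := by
      intro t ht
      by_cases h : t = 1
      · rw [h]; exact E.one_mem
      · exact Subfield.subset_closure (Or.inr (by simp [b', h, ht]))
    refine degree_bound L M G Gt j E ?_ ?_ p hp hcard y (y ^ p - y) ?_ rfl ?_ m hm
    · intro l hl
      exact Subfield.subset_closure (Or.inl ⟨l, hl, rfl⟩)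
    · intro e he σ
      have : E ≤ FixedPoints.subfield Gt M := by
        rw [hEdef, Subfield.closure_le]
        rintro _ (⟨l, hl, rfl⟩ | h)
        · intro τ
          rw [hj, hl]
        · intro τ
          exact hinv _ h τ
      exact this he σ
    · have h1 : y ^ p - y = (y ^ p - y - z) + z := by ring
      rw [h1]
      exact Subfield.add_mem _ (Subfield.subset_closure (Or.inr hyz))
        (Subfield.subset_closure (Or.inl hzE))
    · set Q := Subfield.closure ((E : Set M) ∪ Set.range j ∪ {y}) with hQ
      have hPQ : P ≤ Q := by
        rw [hPdef, Subfield.closure_le]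
        rintro _ (h | h)
        · exact Subfield.subset_closure (Or.inl (Or.inr h))
        · exact Subfield.subset_closure (Or.inr h)
      have hEQ : E ≤ Q := fun e he => Subfield.subset_closure (Or.inl (Or.inl he))
      let QP : Submodule P M :=
        { Q.toAddSubgroup with
          smul_mem' := fun c q hq => Q.mul_mem (hPQ c.2) hq }
      have hbQ : Submodule.span P b ≤ QP := Submodule.span_le.mpr fun t ht => hEQ (hbE t ht)
      have htrQ : Submodule.span P tr ≤ QP := by
        refine le_trans (Submodule.span_le.mpr ?_) hbQ
        intro t ht
        have := hsb ⟨t, Or.inr ht, rfl⟩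
        simpa using this
      rw [eq_top_iff, ← hgen, Subfield.closure_le]
      rintro _ (h | ⟨σ, rfl⟩)
      · exact Subfield.subset_closure (Or.inl (Or.inr h))
      · exact htrQ (hspan σ)

def nX (K : Type*) [Field K] {G : Type*} (g : G) : NoetherBigField K G :=
  algebraMap (MvPolynomial G K) (NoetherBigField K G) (MvPolynomial.X g)

theorem noetherAut_nX (K : Type*) [Field K] {G : Type*} [Group G] (h g : G) :
    noetherAut K G h (nX K g) = nX K (h * g) := by
  unfold noetherAut nX
  simp [IsFractionRing.algEquivOfAlgEquiv_algebraMap]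

theorem nX_injective (K : Type*) [Field K] {G : Type*} :
    Function.Injective (nX K : G → NoetherBigField K G) := by
  intro a b h
  exact MvPolynomial.X_injective (IsFractionRing.injective (MvPolynomial G K) _ h)

theorem closure_nX (K : Type*) [Field K] (G : Type*) :
    Subfield.closure (Set.range (algebraMap K (NoetherBigField K G)) ∪ Set.range (nX K)) = ⊤ := by
  rw [eq_top_iff]
  set Q := Subfield.closure (Set.range (algebraMap K (NoetherBigField K G)) ∪ Set.range (nX K))
  have h : ∀ f : MvPolynomial G K, algebraMap _ (NoetherBigField K G) f ∈ Q := by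
    intro f
    induction f using MvPolynomial.induction_on with
    | C a => exact Subfield.subset_closure (Or.inl ⟨a, rfl⟩)
    | add p q hp hq => rw [map_add]; exact Q.add_mem hp hq
    | mul_X p n hp =>
      rw [map_mul]; exact Q.mul_mem hp (Subfield.subset_closure (Or.inr ⟨n, rfl⟩))
  intro z _
  obtain ⟨a, b, hb, rfl⟩ := IsFractionRing.div_surjective (A := MvPolynomial G K) z
  exact Q.div_mem (h a) (h b)

theorem bigHom_ext (K : Type*) [Field K] {G : Type*} {M : Type*} [Field M] [Algebra K M]
    (f g : NoetherBigField K G →ₐ[K] M) (h : ∀ a, f (nX K a) = g (nX K a)) : f = g := by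
  have : (⊤ : Subfield (NoetherBigField K G)) ≤ RingHom.eqLocusField (f : _ →+* M) (g : _ →+* M) := by
    rw [← closure_nX, Subfield.closure_le]
    rintro _ (⟨a, rfl⟩ | ⟨a, rfl⟩)
    · change f _ = g _
      simp
    · exact h a
  refine AlgHom.ext fun z => ?_
  exact this (Subfield.mem_top z)

@[reducible] def bigAction (K : Type*) [Field K] (G : Type*) [Group G] :
    MulSemiringAction G (NoetherBigField K G) where
  smul h x := noetherAut K G h x
  one_smul x := by
    have : (noetherAut K G 1 : NoetherBigField K G →ₐ[K] NoetherBigField K G) = AlgHom.id K _ := by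
      apply bigHom_ext
      intro a
      change noetherAut K G 1 (nX K a) = nX K a
      rw [noetherAut_nX, one_mul]
    exact DFunLike.congr_fun this x
  mul_smul g h x := by
    have : (noetherAut K G (g * h) : NoetherBigField K G →ₐ[K] NoetherBigField K G) =
        (noetherAut K G g : NoetherBigField K G →ₐ[K] NoetherBigField K G).comp
          (noetherAut K G h : NoetherBigField K G →ₐ[K] NoetherBigField K G) := by
      apply bigHom_ext
      intro a
      change noetherAut K G (g * h) (nX K a) = noetherAut K G g (noetherAut K G h (nX K a))
      rw [noetherAut_nX, noetherAut_nX, noetherAut_nX, mul_assoc]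
    exact DFunLike.congr_fun this x
  smul_zero h := map_zero (noetherAut K G h)
  smul_add h := map_add (noetherAut K G h)
  smul_one h := map_one (noetherAut K G h)
  smul_mul h := map_mul (noetherAut K G h)

open Classical in
def jPoly (K : Type*) [Field K] {Gt G : Type*} [Fintype Gt] (π : Gt → G) :
    MvPolynomial G K →ₐ[K] MvPolynomial Gt K :=
  MvPolynomial.aeval (fun g => ∑ τ : Gt with π τ = g, MvPolynomial.X τ)

theorem jPoly_injective (K : Type*) [Field K] {Gt G : Type*} [Fintype Gt] (π : Gt → G)
    (hπ : Function.Surjective π) : Function.Injective (jPoly K π) := by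
  classical
  let s := Function.surjInv hπ
  let r : MvPolynomial Gt K →ₐ[K] MvPolynomial G K :=
    MvPolynomial.aeval (fun τ => if τ = s (π τ) then MvPolynomial.X (π τ) else 0)
  have : r.comp (jPoly K π) = AlgHom.id K _ := by
    apply MvPolynomial.algHom_ext
    intro g
    simp only [jPoly, AlgHom.comp_apply, MvPolynomial.aeval_X, map_sum, r, AlgHom.id_apply]
    rw [Finset.sum_eq_single (s g)]
    · simp [s, Function.surjInv_eq hπ]
    · intro τ hτ hne
      have h1 : π τ = g := by simpa using hτ
      rw [if_neg]
      rw [h1]; exact hne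
    · intro h
      simp [s, Function.surjInv_eq hπ] at h
  intro a b hab
  have h := congrArg r hab
  have h2 := fun z => DFunLike.congr_fun this z
  simp only [AlgHom.comp_apply, AlgHom.id_apply] at h2
  rwa [h2, h2] at h

def jMap (K : Type*) [Field K] {Gt G : Type*} [Fintype Gt] (π : Gt → G)
    (hπ : Function.Surjective π) : NoetherBigField K G →ₐ[K] NoetherBigField K Gt :=
  IsFractionRing.liftAlgHom (A := MvPolynomial G K)
    (g := (IsScalarTower.toAlgHom K (MvPolynomial Gt K) (NoetherBigField K Gt)).comp (jPoly K π))
    (by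
      rw [AlgHom.coe_comp]
      exact (IsFractionRing.injective (MvPolynomial Gt K) (NoetherBigField K Gt)).comp
        (jPoly_injective K π hπ))

open Classical in
theorem jMap_nX (K : Type*) [Field K] {Gt G : Type*} [Fintype Gt] (π : Gt → G)
    (hπ : Function.Surjective π) (g : G) :
    jMap K π hπ (nX K g) = ∑ τ : Gt with π τ = g, nX K τ := by
  unfold jMap nX
  rw [IsFractionRing.liftAlgHom_apply, IsFractionRing.lift_algebraMap]
  simp [jPoly]

theorem jMap_equiv (K : Type*) [Field K] {Gt G : Type*} [Group Gt] [Group G] [Fintype Gt]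
    (π : Gt →* G) (hπ : Function.Surjective π) (σ : Gt) (l : NoetherBigField K G) :
    noetherAut K Gt σ (jMap K π hπ l) = jMap K π hπ (noetherAut K G (π σ) l) := by
  classical
  have : (noetherAut K Gt σ : NoetherBigField K Gt →ₐ[K] NoetherBigField K Gt).comp
      (jMap K π hπ) = (jMap K π hπ).comp
        (noetherAut K G (π σ) : NoetherBigField K G →ₐ[K] NoetherBigField K G) := by
    apply bigHom_ext
    intro a
    change noetherAut K Gt σ (jMap K π hπ (nX K a)) = jMap K π hπ (noetherAut K G (π σ) (nX K a))
    rw [noetherAut_nX, jMap_nX, jMap_nX, map_sum]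
    simp only [noetherAut_nX]
    refine Finset.sum_equiv (Equiv.mulLeft σ) ?_ ?_
    · intro τ; simp
    · intro τ _; rfl
  exact DFunLike.congr_fun this l

def iotaMap (K : Type*) [Field K] {Gt G : Type*} [Group Gt] [Group G] [Fintype Gt]
    (π : Gt →* G) (hπ : Function.Surjective π) : NoetherField K G →ₐ[K] NoetherField K Gt where
  toFun l := ⟨jMap K π hπ l.1, fun σ => by rw [jMap_equiv, l.2]⟩
  map_one' := Subtype.ext (map_one (jMap K π hπ))
  map_mul' a b := Subtype.ext (map_mul (jMap K π hπ) a.1 b.1)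
  map_zero' := Subtype.ext (map_zero (jMap K π hπ))
  map_add' a b := Subtype.ext (map_add (jMap K π hπ) a.1 b.1)
  commutes' r := Subtype.ext ((jMap K π hπ).commutes r)

/-- generation data -/
def GoodEmb (K : Type*) [Field K] (Gt G : Type*) [Group Gt] [Group G] : Prop :=
  ∃ ι : NoetherField K G →ₐ[K] NoetherField K Gt, ∃ s : Finset (NoetherField K Gt),
    s.card + Nat.card G ≤ Nat.card Gt ∧
    Subfield.closure (Set.range ι ∪ (s : Set (NoetherField K Gt))) = ⊤

theorem GoodEmb.trans {K : Type*} [Field K] {A B C : Type*} [Group A] [Group B] [Group C]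
    (h1 : GoodEmb K A B) (h2 : GoodEmb K B C) : GoodEmb K A C := by
  classical
  obtain ⟨i, s, hs, hsg⟩ := h1
  obtain ⟨i', s', hs', hsg'⟩ := h2
  refine ⟨i.comp i', s ∪ s'.image i, ?_, ?_⟩
  · have := Finset.card_union_le s (s'.image i)
    have := Finset.card_image_le (s := s') (f := i)
    omega
  · set Q := Subfield.closure (Set.range (i.comp i') ∪
      ((s ∪ s'.image i : Finset (NoetherField K A)) : Set (NoetherField K A)))
    have hr : (⊤ : Subfield (NoetherField K B)) ≤ Q.comap (i : NoetherField K B →+* NoetherField K A) := by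
      rw [← hsg', Subfield.closure_le]
      rintro _ (⟨l, rfl⟩ | h)
      · exact Subfield.subset_closure (Or.inl ⟨l, rfl⟩)
      · refine Subfield.subset_closure (Or.inr ?_)
        rw [Finset.mem_coe, Finset.mem_union]
        exact Or.inr (Finset.mem_image_of_mem _ h)
    rw [eq_top_iff, ← hsg, Subfield.closure_le]
    rintro _ (⟨l, rfl⟩ | h)
    · exact hr (Subfield.mem_top l)
    · refine Subfield.subset_closure (Or.inr ?_)
      rw [Finset.mem_coe, Finset.mem_union]
      exact Or.inl h

theorem good_of_gens (K : Type*) [Field K] {Gt G : Type*} [Group Gt] [Group G] [Fintype Gt]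
    (π : Gt →* G) (hπ : Function.Surjective π) (s : Finset (NoetherBigField K Gt))
    (hs : s.card + Nat.card G ≤ Nat.card Gt) (hinv : ∀ t ∈ s, ∀ σ, noetherAut K Gt σ t = t)
    (hgen : ∀ m, (∀ σ, noetherAut K Gt σ m = m) →
      m ∈ Subfield.closure (jMap K π hπ '' {l | ∀ g, noetherAut K G g l = l} ∪
        (s : Set (NoetherBigField K Gt)))) : GoodEmb K Gt G := by
  classical
  let f : {t // t ∈ s} → NoetherField K Gt := fun t => ⟨t.1, hinv t.1 t.2⟩
  refine ⟨iotaMap K π hπ, s.attach.image f, ?_, ?_⟩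
  · have := Finset.card_image_le (s := s.attach) (f := f)
    rw [Finset.card_attach] at this
    omega
  · set Q := Subfield.closure (Set.range (iotaMap K π hπ) ∪
      ((s.attach.image f : Finset (NoetherField K Gt)) : Set (NoetherField K Gt)))
    let v : NoetherField K Gt →+* NoetherBigField K Gt := (noetherSubfield K Gt).subtype
    rw [eq_top_iff]
    intro m _
    have h1 : (m.1 : NoetherBigField K Gt) ∈ Q.map v := by
      refine (Subfield.closure_le.mpr ?_) (hgen m.1 m.2)
      rintro _ (⟨l, hl, rfl⟩ | h)
      · exact ⟨iotaMap K π hπ ⟨l, hl⟩, Subfield.subset_closure (Or.inl ⟨_, rfl⟩), rfl⟩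
      · refine ⟨f ⟨_, h⟩, Subfield.subset_closure (Or.inr ?_), rfl⟩
        rw [Finset.mem_coe]
        exact Finset.mem_image_of_mem _ (Finset.mem_attach _ _)
    obtain ⟨q, hq, hqm⟩ := h1
    have : q = m := Subtype.ext hqm
    exact this ▸ hq

theorem good_of_bijective (K : Type*) [Field K] {Gt G : Type*} [Group Gt] [Group G] [Fintype Gt]
    (π : Gt →* G) (hπ : Function.Bijective π) : GoodEmb K Gt G := by
  classical
  refine good_of_gens K π hπ.2 ∅ ?_ (by simp) ?_
  · rw [Nat.card_congr (Equiv.ofBijective π hπ)]; simp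
  · intro m hm
    have hx : ∀ τ, jMap K π hπ.2 (nX K (π τ)) = nX K τ := by
      intro τ
      rw [jMap_nX, Finset.sum_eq_single τ]
      · intro b hb hne
        exact absurd (hπ.1 (by simpa using hb)) hne
      · simp
    have h1 : (⊤ : Subfield (NoetherBigField K Gt)) ≤
        (jMap K π hπ.2 : NoetherBigField K G →+* NoetherBigField K Gt).fieldRange := by
      rw [← closure_nX, Subfield.closure_le]
      rintro _ (⟨a, rfl⟩ | ⟨a, rfl⟩)
      · exact ⟨algebraMap K _ a, (jMap K π hπ.2).commutes a⟩
      · exact ⟨_, hx a⟩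
    obtain ⟨l, rfl⟩ := h1 (Subfield.mem_top m)
    refine Subfield.subset_closure (Or.inl ⟨l, ?_, rfl⟩)
    intro g
    obtain ⟨σ, rfl⟩ := hπ.2 g
    apply (jMap K π hπ.2).injective
    exact (jMap_equiv K π hπ.2 σ l).symm.trans (hm σ)

theorem exists_phi (K : Type*) [Field K] (p : ℕ) [CharP K p] {Gt G : Type*} [Group Gt] [Group G]
    (π : Gt →* G) (hπ : Function.Surjective π) (c : Gt) (hc : orderOf c = p)
    (hker : π.ker = Subgroup.zpowers c) :
    ∃ φ : Gt → K, (∀ τ, ∀ k : ℤ, φ (τ * c ^ k) = φ τ + k) ∧ (∀ g, ∃ τ, π τ = g ∧ φ τ = 0) := by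
  have hpc : π c = 1 := by
    have : c ∈ π.ker := hker ▸ Subgroup.mem_zpowers c
    exact this
  have h : ∀ τ, ∃ k : ℤ, c ^ k = (Function.surjInv hπ (π τ))⁻¹ * τ := by
    intro τ
    rw [← Subgroup.mem_zpowers_iff, ← hker, MonoidHom.mem_ker]
    simp [Function.surjInv_eq hπ]
  choose k hk using h
  refine ⟨fun τ => (k τ : K), ?_, ?_⟩
  · intro τ n
    change ((k (τ * c ^ n) : ℤ) : K) = (k τ : K) + (n : K)
    rw [← Int.cast_add, CharP.intCast_eq_intCast K p, ← hc, ← zpow_eq_zpow_iff_modEq, hk, zpow_add,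
      hk]
    simp [hpc, mul_assoc]
  · intro g
    refine ⟨Function.surjInv hπ g, Function.surjInv_eq hπ g, ?_⟩
    change ((k (Function.surjInv hπ g) : ℤ) : K) = 0
    rw [← Int.cast_zero, CharP.intCast_eq_intCast K p, ← hc, ← zpow_eq_zpow_iff_modEq, hk]
    simp [Function.surjInv_eq hπ]

theorem good_step (K : Type*) [Field K] (p : ℕ) (hp : p.Prime) [CharP K p]
    {Gt G : Type*} [Group Gt] [Group G] [Fintype Gt]
    (π : Gt →* G) (hπ : Function.Surjective π) (c : Gt) (hc : orderOf c = p)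
    (hker : π.ker = Subgroup.zpowers c) (hcen : ∀ τ, c * τ = τ * c) : GoodEmb K Gt G := by
  classical
  have : Finite G := Finite.of_surjective π hπ
  let _ : Fintype G := Fintype.ofFinite G
  have : Fact p.Prime := ⟨hp⟩
  obtain ⟨φ, hφ, hsec⟩ := exists_phi K p π hπ c hc hker
  have hfib : ∀ τ τ', π τ = π τ' → ∃ k : ℤ, τ' = τ * c ^ k := by
    intro τ τ' h
    have : τ⁻¹ * τ' ∈ π.ker := by rw [MonoidHom.mem_ker, map_mul, map_inv, h, inv_mul_cancel]
    rw [hker, Subgroup.mem_zpowers_iff] at this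
    obtain ⟨k, hk⟩ := this
    exact ⟨k, by rw [hk]; group⟩
  have hcast : ∀ k : ℤ, (k : K) = 0 → c ^ k = 1 := by
    intro k hk
    rw [CharP.intCast_eq_zero_iff K p] at hk
    rw [← hc] at hk
    exact orderOf_dvd_iff_zpow_eq_one.mp hk
  let := bigAction K G
  let := bigAction K Gt
  have hsm : ∀ (σ : Gt) (m : NoetherBigField K Gt), σ • m = noetherAut K Gt σ m := fun _ _ => rfl
  have hsmL : ∀ (σ : G) (m : NoetherBigField K G), σ • m = noetherAut K G σ m := fun _ _ => rfl
  have hsx : ∀ σ τ : Gt, σ • nX K τ = nX K (σ * τ) := fun σ τ => noetherAut_nX K σ τ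
  have hsxL : ∀ σ τ : G, σ • nX K τ = nX K (σ * τ) := fun σ τ => noetherAut_nX K σ τ
  have hsc : ∀ (σ : Gt) (a : K), σ • algebraMap K (NoetherBigField K Gt) a =
    algebraMap K (NoetherBigField K Gt) a := fun σ a => (noetherAut K Gt σ).commutes a
  have : FaithfulSMul Gt (NoetherBigField K Gt) := ⟨by
    intro σ τ h
    have := h (nX K 1)
    rw [hsx, hsx, mul_one, mul_one] at this
    exact nX_injective K this⟩
  have : CharP (NoetherBigField K Gt) p :=
    charP_of_injective_algebraMap (algebraMap K (NoetherBigField K Gt)).injective p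
  set j := jMap K π hπ with hjdef
  have hj : ∀ (σ : Gt) (l : NoetherBigField K G), σ • j l = j (π σ • l) := jMap_equiv K π hπ
  have hjx : ∀ g, j (nX K g) = ∑ τ : Gt with π τ = g, nX K τ := jMap_nX K π hπ
  have hconst : ∀ f : Gt → K, (∀ τ, ∀ k : ℤ, f (τ * c ^ k) = f τ) →
      ∃ l, j l = ∑ τ, algebraMap K (NoetherBigField K Gt) (f τ) * nX K τ := by
    intro f hf
    refine ⟨∑ g, algebraMap K _ (f (Function.surjInv hπ g)) * nX K g, ?_⟩
    rw [map_sum, ← Finset.sum_fiberwise (s := Finset.univ) (g := π)]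
    refine Finset.sum_congr rfl fun g _ => ?_
    rw [map_mul, hjx, AlgHom.commutes, Finset.mul_sum]
    refine Finset.sum_congr rfl fun τ hτ => ?_
    have h1 : π τ = g := by simpa using hτ
    obtain ⟨k, hk⟩ := hfib τ (Function.surjInv hπ g) (by rw [h1, Function.surjInv_eq hπ])
    rw [hk, hf]
  set D : NoetherBigField K Gt := ∑ τ, nX K τ with hD
  have hDσ : ∀ σ : Gt, σ • D = D := by
    intro σ
    rw [hD, Finset.smul_sum]
    simp only [hsx]
    exact Fintype.sum_equiv (Equiv.mulLeft σ) _ _ (fun _ => rfl)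
  have hD0 : D ≠ 0 := by
    intro h0
    have h1 : algebraMap (MvPolynomial Gt K) (NoetherBigField K Gt) (∑ τ, MvPolynomial.X τ) = 0 := by
      rw [map_sum]; exact h0
    rw [map_eq_zero_iff _ (IsFractionRing.injective (MvPolynomial Gt K) (NoetherBigField K Gt))] at h1
    have h2 := congrArg (MvPolynomial.eval (Pi.single (1 : Gt) (1 : K))) h1
    simp [Pi.single_apply] at h2
  set DL : NoetherBigField K G := ∑ g, nX K g with hDL
  have hjD : j DL = D := by
    rw [hDL, hD, map_sum, ← Finset.sum_fiberwise (s := Finset.univ) (g := π)]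
    exact Finset.sum_congr rfl fun g _ => hjx g
  set U : NoetherBigField K Gt := ∑ τ, algebraMap K (NoetherBigField K Gt) (φ τ) * nX K τ with hU
  have hσU : ∀ σ : Gt, σ • U - U =
      ∑ τ, algebraMap K (NoetherBigField K Gt) (φ (σ⁻¹ * τ) - φ τ) * nX K τ := by
    intro σ
    have : σ • U = ∑ τ, algebraMap K (NoetherBigField K Gt) (φ (σ⁻¹ * τ)) * nX K τ := by
      rw [hU, Finset.smul_sum]
      simp only [smul_mul', hsc, hsx]
      refine Fintype.sum_equiv (Equiv.mulLeft σ) _ _ (fun τ => ?_)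
      simp
    rw [this, hU, ← Finset.sum_sub_distrib]
    refine Finset.sum_congr rfl fun τ _ => ?_
    rw [map_sub, sub_mul]
  set y := U / D with hy
  have hσy : ∀ σ : Gt, σ • y - y = (σ • U - U) / D := by
    intro σ
    have : σ • y = σ • U / D := by
      rw [hy, hsm, map_div₀, ← hsm, ← hsm, hDσ]
    rw [this, hy, sub_div]
  have hb : ∀ σ : Gt, ∃ l, j l = σ • y - y := by
    intro σ
    obtain ⟨l, hl⟩ := hconst (fun τ => φ (σ⁻¹ * τ) - φ τ) (by
      intro τ k
      simp only [← mul_assoc, hφ]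
      ring)
    refine ⟨l / DL, ?_⟩
    rw [map_div₀, hjD, hl, hσy, hσU]
  have hcomm : ∀ (k : ℤ) τ, c ^ k * τ = τ * c ^ k := by
    intro k τ
    exact (Commute.zpow_left (hcen τ) k)
  have hcy : ∀ k : ℤ, (c ^ k) • y - y = -(k : NoetherBigField K Gt) := by
    intro k
    rw [hσy, hσU, div_eq_iff hD0, hD, Finset.mul_sum]
    refine Finset.sum_congr rfl fun τ _ => ?_
    rw [← zpow_neg, hcomm, hφ]
    simp
  have hf : ∀ σ : Gt, (∀ l, σ • j l = j l) → σ • y = y → σ = 1 := by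
    intro σ h1 h2
    have h3 := h1 (nX K 1)
    rw [hj, hsxL, mul_one] at h3
    have h4 : π σ = 1 := nX_injective K (j.injective h3)
    obtain ⟨k, hk⟩ := hfib 1 σ (by rw [h4, map_one])
    rw [one_mul] at hk
    have h5 := hcy k
    rw [← hk, h2, sub_self, eq_comm, neg_eq_zero] at h5
    rw [hk]
    apply hcast
    apply (algebraMap K (NoetherBigField K Gt)).injective
    simpa using h5
  set z0 := y ^ p - y with hz0
  have hσz0 : ∀ (σ : Gt), σ • z0 - z0 = (σ • y - y) ^ p - (σ • y - y) := by
    intro σ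
    rw [sub_pow_char, hz0, smul_sub, smul_pow']
    ring
  have hcz0 : ∀ k : ℤ, (c ^ k) • z0 = z0 := by
    intro k
    rw [← sub_eq_zero, hσz0, hcy, sub_eq_zero]
    have := map_intCast (frobenius (NoetherBigField K Gt) p) (-k)
    rw [frobenius_def] at this
    simpa using this
  set a := j (nX K 1 / DL) with ha
  have hca : ∀ k : ℤ, (c ^ k) • a = a := by
    intro k
    have h1 : π (c ^ k) = 1 := by
      have : c ^ k ∈ π.ker := hker ▸ Subgroup.zpow_mem_zpowers c k
      exact this
    rw [ha, hj, h1, one_smul]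
  have haz : ∀ σ τ : Gt, π σ = π τ → σ • (a * z0) = τ • (a * z0) := by
    intro σ τ h
    obtain ⟨k, rfl⟩ := hfib σ τ h
    rw [mul_smul, smul_mul' (c ^ k), hca, hcz0]
  let s := Function.surjInv hπ
  have hs : ∀ g, π (s g) = g := Function.surjInv_eq hπ
  set z := ∑ g, s g • (a * z0) with hz
  have hzinv : ∀ σ : Gt, σ • z = z := by
    intro σ
    rw [hz, Finset.smul_sum]
    refine Fintype.sum_equiv (Equiv.mulLeft (π σ)) _ _ (fun g => ?_)
    rw [smul_smul]
    apply haz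
    simp [hs]
  have hDLg : ∀ g : G, g • DL = DL := by
    intro g
    rw [hDL, Finset.smul_sum]
    simp only [hsxL]
    exact Fintype.sum_equiv (Equiv.mulLeft g) _ _ (fun _ => rfl)
  have hDL0 : DL ≠ 0 := by
    intro h
    rw [h, map_zero] at hjD
    exact hD0 hjD.symm
  have hsa : ∀ g, s g • a = j (nX K g / DL) := by
    intro g
    rw [ha, hj, hs, hsmL, map_div₀, ← hsmL, ← hsmL, hDLg, hsxL, mul_one]
  have hsum : ∑ g, s g • a = 1 := by
    simp only [hsa]
    rw [← map_sum, ← Finset.sum_div, div_self hDL0, map_one]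
  choose β hβ using hb
  have hyz : ∃ l, j l = y ^ p - y - z := by
    refine ⟨- ∑ g, (nX K g / DL) * ((β (s g)) ^ p - β (s g)), ?_⟩
    have h1 : z = ∑ g, (s g • a * z0 + s g • a * (s g • z0 - z0)) := by
      rw [hz]
      refine Finset.sum_congr rfl fun g _ => ?_
      rw [smul_mul']; ring
    rw [h1, Finset.sum_add_distrib, ← Finset.sum_mul, hsum, one_mul, ← hz0, sub_add_cancel_left,
      map_neg, map_sum]
    congr 1
    refine Finset.sum_congr rfl fun g _ => ?_
    rw [map_mul, map_sub, map_pow, hβ, hsa, hσz0]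
  obtain ⟨τ1, -, hτ1⟩ := hsec 1
  set τ0 := τ1 * c with hτ0
  have hφ0 : φ τ0 = 1 := by
    have := hφ τ1 1
    simpa [hτ1] using this
  set N : Finset Gt := Finset.univ.filter (fun τ => φ τ ≠ 0) with hN
  have hτ0N : τ0 ∈ N := by simp [hN, hφ0]
  have hNcard : N.card + Fintype.card G ≤ Fintype.card Gt := by
    have h1 : Fintype.card G ≤ (Finset.univ.filter (fun τ => φ τ = 0)).card := by
      rw [← Finset.card_univ]
      apply Finset.card_le_card_of_surjOn π
      intro g _
      obtain ⟨τ, h1, h2⟩ := hsec g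
      exact ⟨τ, by simpa using h2, h1⟩
    have h2 := Finset.card_filter_add_card_filter_not (s := (Finset.univ : Finset Gt)) (fun τ => φ τ = 0)
    rw [Finset.card_univ] at h2
    simp only [hN, ne_eq]
    omega
  have hcard : Fintype.card Gt = Fintype.card G * p := by
    have h1 := Subgroup.card_mul_index π.ker
    rw [Subgroup.index_ker, MonoidHom.range_eq_top.mpr hπ, hker, Nat.card_zpowers, hc] at h1
    rw [← Nat.card_eq_fintype_card, ← Nat.card_eq_fintype_card, ← h1, mul_comm]
    simp
  have hone : ∀ τ : Gt, nX K τ = τ • nX K (1 : Gt) := fun τ => by rw [hsx, mul_one]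
  obtain ⟨S, hS1, hS2, hS3⟩ := step_abstract (NoetherBigField K G) (NoetherBigField K Gt) G Gt π
    (j : NoetherBigField K G →+* NoetherBigField K Gt) hj (nX K 1) y z p hp hcard
    (by
      rw [eq_top_iff, ← closure_nX]
      apply Subfield.closure_mono
      apply Set.union_subset_union
      · rintro _ ⟨r, rfl⟩
        exact ⟨algebraMap K _ r, j.commutes r⟩
      · rintro _ ⟨τ, rfl⟩
        exact ⟨τ, (hone τ).symm⟩)
    (fun σ => ⟨β σ, hβ σ⟩) hf hzinv hyz (N.erase τ0)
    (by
      set P := Subfield.closure (Set.range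
        (j : NoetherBigField K G →+* NoetherBigField K Gt) ∪ {y}) with hP
      have hjP : ∀ l, j l ∈ P := fun l => Subfield.subset_closure (Or.inl ⟨l, rfl⟩)
      have hyP : y ∈ P := Subfield.subset_closure (Or.inr rfl)
      have hKP : ∀ r, algebraMap K (NoetherBigField K Gt) r ∈ P := by
        intro r
        rw [← j.commutes r]
        exact hjP _
      set W := Submodule.span P (insert (1 : NoetherBigField K Gt)
        ((fun σ : Gt => σ • nX K (1 : Gt)) '' ((N.erase τ0 : Finset Gt) : Set Gt))) with hW
      have hPW : ∀ q ∈ P, q ∈ W := by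
        intro q hq
        have := W.smul_mem (⟨q, hq⟩ : P) (Submodule.subset_span (Or.inl rfl))
        rwa [Subfield.smul_def, smul_eq_mul, mul_one] at this
      have hTW : ∀ τ ∈ N.erase τ0, nX K τ ∈ W := by
        intro τ hτ
        exact Submodule.subset_span (Or.inr ⟨τ, hτ, (hone τ).symm⟩)
      have h0W : nX K τ0 ∈ W := by
        have h1 : nX K τ0 = U - ∑ τ ∈ N.erase τ0,
            algebraMap K (NoetherBigField K Gt) (φ τ) * nX K τ := by
          have h2 : U = ∑ τ ∈ N, algebraMap K (NoetherBigField K Gt) (φ τ) * nX K τ := by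
            rw [hU, hN, Finset.sum_filter]
            refine Finset.sum_congr rfl fun τ _ => ?_
            by_cases h : φ τ = 0 <;> simp [h]
          rw [h2, ← Finset.add_sum_erase _ _ hτ0N, hφ0, map_one, one_mul]
          ring
        rw [h1]
        refine W.sub_mem (hPW _ ?_) (W.sum_mem fun τ hτ => ?_)
        · have : U = y * j DL := by rw [hjD, hy, div_mul_cancel₀ _ hD0]
          rw [this]
          exact P.mul_mem hyP (hjP _)
        · exact W.smul_mem (⟨_, hKP (φ τ)⟩ : P) (hTW τ hτ)
      have hNW : ∀ τ ∈ N, nX K τ ∈ W := by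
        intro τ hτ
        by_cases h : τ = τ0
        · rw [h]; exact h0W
        · exact hTW τ (Finset.mem_erase.mpr ⟨h, hτ⟩)
      intro τ
      rw [← hone]
      by_cases h : φ τ = 0
      · have h1 : nX K τ = j (nX K (π τ)) -
            ∑ τ' ∈ (Finset.univ.filter (fun τ' => π τ' = π τ)).erase τ, nX K τ' := by
          rw [hjx, ← Finset.add_sum_erase _ _ (show τ ∈ Finset.univ.filter (fun τ' => π τ' = π τ) by simp)]
          ring
        rw [h1]
        refine W.sub_mem (hPW _ (hjP _)) (W.sum_mem fun τ' hτ' => hNW τ' ?_)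
        rw [Finset.mem_erase] at hτ'
        have h2 : π τ' = π τ := by simpa using hτ'.2
        obtain ⟨k, rfl⟩ := hfib τ τ' h2.symm
        simp only [hN, Finset.mem_filter, Finset.mem_univ, true_and]
        intro h3
        rw [hφ, h, zero_add] at h3
        apply hτ'.1
        rw [hcast k h3, mul_one]
      · exact hNW τ (by simp [hN, h]))
  refine good_of_gens K π hπ S ?_ hS2 hS3
  have : 0 < N.card := Finset.card_pos.mpr ⟨_, hτ0N⟩
  rw [Finset.card_erase_of_mem hτ0N] at hS1
  rw [Nat.card_eq_fintype_card, Nat.card_eq_fintype_card]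
  omega

universe u

theorem good_all (K : Type*) [Field K] (p : ℕ) (hp : p.Prime) [CharP K p] {G : Type*} [Group G]
    (n : ℕ) : ∀ (Gt : Type u) [Group Gt] [Finite Gt] (π : Gt →* G), Function.Surjective π →
      IsPGroup p π.ker → π.ker ≤ Subgroup.center Gt → Nat.card π.ker = n → GoodEmb K Gt G := by
  induction n using Nat.strong_induction_on with
  | _ n ih =>
  intro Gt _ _ π hπ hpk hcen hn
  have : Fact p.Prime := ⟨hp⟩
  let _ : Fintype Gt := Fintype.ofFinite Gt
  by_cases h1 : n = 1
  · have hbot : π.ker = ⊥ := by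
      rw [← Subgroup.card_eq_one]; omega
    exact good_of_bijective K π ⟨(MonoidHom.ker_eq_bot_iff π).mp hbot, hπ⟩
  · obtain ⟨k, hk⟩ := IsPGroup.iff_card.mp hpk
    have hk0 : k ≠ 0 := by
      rintro rfl
      rw [pow_zero] at hk; omega
    have hdvd : p ∣ Nat.card π.ker := by rw [hk]; exact dvd_pow_self p hk0
    obtain ⟨c', hc'⟩ := exists_prime_orderOf_dvd_card' p hdvd
    let c : Gt := c'
    have hc : orderOf c = p := by rw [← hc']; exact Subgroup.orderOf_coe c'
    have hcc : c ∈ Subgroup.center Gt := hcen c'.2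
    have hle : Subgroup.zpowers c ≤ π.ker := by
      rw [Subgroup.zpowers_le]; exact c'.2
    have hnorm : (Subgroup.zpowers c).Normal :=
      ⟨fun a ha g => by
        rw [Subgroup.mem_center_iff.mp (hcen (hle ha)) g, mul_inv_cancel_right]
        exact ha⟩
    have hg1 : GoodEmb K Gt (Gt ⧸ Subgroup.zpowers c) := by
      refine good_step K p hp (QuotientGroup.mk' (Subgroup.zpowers c))
        (QuotientGroup.mk'_surjective _) c hc (QuotientGroup.ker_mk' _) ?_
      intro τ
      exact (Subgroup.mem_center_iff.mp hcc τ).symm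
    let π' : (Gt ⧸ Subgroup.zpowers c) →* G := QuotientGroup.lift (Subgroup.zpowers c) π hle
    have hker' : π'.ker = π.ker.map (QuotientGroup.mk' (Subgroup.zpowers c)) :=
      QuotientGroup.ker_lift (Subgroup.zpowers c) π hle
    have hπ' : Function.Surjective π' := by
      intro g
      obtain ⟨τ, rfl⟩ := hπ g
      exact ⟨QuotientGroup.mk τ, rfl⟩
    refine hg1.trans (ih (Nat.card π'.ker) ?_ (Gt ⧸ Subgroup.zpowers c) π' hπ' ?_ ?_ rfl)
    · have e1 := Subgroup.card_mul_index π.ker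
      have e2 := Subgroup.card_mul_index π'.ker
      have e3 := Subgroup.card_mul_index (Subgroup.zpowers c)
      rw [Subgroup.index_ker, MonoidHom.range_eq_top.mpr hπ] at e1
      rw [Subgroup.index_ker, MonoidHom.range_eq_top.mpr hπ'] at e2
      rw [Nat.card_zpowers, hc, Subgroup.index_eq_card, ← e2] at e3
      have hfin : Finite G := Finite.of_surjective π hπ
      have hpos : 0 < Nat.card (⊤ : Subgroup G) := Nat.card_pos
      have e4 : p * Nat.card π'.ker = n := by
        rw [← hn]
        apply Nat.eq_of_mul_eq_mul_right hpos
        rw [e1, ← e3]; ring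
      have hpos' : 0 < Nat.card π'.ker := Nat.card_pos
      rw [← e4]
      nlinarith [hp.one_lt]
    · rw [hker']
      exact hpk.map _
    · rw [hker']
      rintro _ ⟨τ, hτ, rfl⟩
      rw [Subgroup.mem_center_iff]
      intro q
      obtain ⟨ρ, rfl⟩ := QuotientGroup.mk'_surjective _ q
      rw [← map_mul, ← map_mul, Subgroup.mem_center_iff.mp (hcen hτ) ρ]

theorem trdeg_big (K : Type*) [Field K] (G : Type*) [Finite G] :
    Algebra.trdeg K (NoetherBigField K G) = (Nat.card G : Cardinal) := by
  have h := trdeg_add_eq K (MvPolynomial G K) (A := NoetherBigField K G)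
  have h0 : Algebra.trdeg (MvPolynomial G K) (NoetherBigField K G) = 0 := by
    have : Algebra.IsAlgebraic (MvPolynomial G K) (NoetherBigField K G) :=
      IsLocalization.isAlgebraic _ (nonZeroDivisors (MvPolynomial G K))
    exact trdeg_eq_zero
  rw [← h, h0, add_zero, MvPolynomial.trdeg_of_isDomain, ← Nat.cast_card]
  simp

theorem trdeg_noether (K : Type*) [Field K] (G : Type*) [Group G] [Finite G] :
    Algebra.trdeg K (NoetherField K G) = (Nat.card G : Cardinal) := by
  let _ := bigAction K G
  let _ : Algebra (NoetherField K G) (NoetherBigField K G) :=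
    (noetherSubfield K G).subtype.toAlgebra
  have : IsScalarTower K (NoetherField K G) (NoetherBigField K G) :=
    IsScalarTower.of_algebraMap_eq (fun _ => rfl)
  have hfd : FiniteDimensional (FixedPoints.subfield G (NoetherBigField K G))
    (NoetherBigField K G) := inferInstance
  have hfd' : FiniteDimensional (NoetherField K G) (NoetherBigField K G) := hfd
  have h := trdeg_add_eq K (NoetherField K G) (A := NoetherBigField K G)
  have h0 : Algebra.trdeg (NoetherField K G) (NoetherBigField K G) = 0 := trdeg_eq_zero
  rw [h0, add_zero] at h
  rw [h, trdeg_big]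

theorem noether_final (K : Type*) [Field K] (Gt G : Type*) [Group Gt] [Group G] [Finite Gt]
    [Finite G] (h : GoodEmb K Gt G) :
    ∃ ι : NoetherField K G →ₐ[K] NoetherField K Gt,
      @IsRationalExtension (NoetherField K G) (NoetherField K Gt) _ _
        ι.toRingHom.toAlgebra := by
  obtain ⟨ι, s, hs, hgen⟩ := h
  refine ⟨ι, ?_⟩
  let _ : Algebra (NoetherField K G) (NoetherField K Gt) := ι.toRingHom.toAlgebra
  have : IsScalarTower K (NoetherField K G) (NoetherField K Gt) :=
    IsScalarTower.of_algebraMap_eq (fun r => (ι.commutes r).symm)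
  apply rat_of_gens (NoetherField K G) (NoetherField K Gt) s
  · rw [eq_top_iff]
    have h1 : (⊤ : Subfield (NoetherField K Gt)) ≤
        (IntermediateField.adjoin (NoetherField K G) (s : Set (NoetherField K Gt))).toSubfield := by
      rw [← hgen, Subfield.closure_le]
      rintro _ (⟨l, rfl⟩ | h)
      · exact (IntermediateField.adjoin (NoetherField K G)
          (s : Set (NoetherField K Gt))).algebraMap_mem l
      · exact IntermediateField.subset_adjoin _ _ h
    intro m _
    exact h1 (Subfield.mem_top m)
  · have h := lift_trdeg_add_eq K (NoetherField K G) (NoetherField K Gt)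
    rw [trdeg_noether, trdeg_noether, Cardinal.lift_natCast, Cardinal.lift_natCast] at h
    have hlt : Algebra.trdeg (NoetherField K G) (NoetherField K Gt) < Cardinal.aleph0 := by
      have hle := le_trans (le_add_of_nonneg_left zero_le) h.le
      exact Cardinal.lift_lt_aleph0.mp (lt_of_le_of_lt hle Cardinal.natCast_lt_aleph0)
    obtain ⟨d, hd⟩ := Cardinal.lt_aleph0.mp hlt
    rw [hd, Cardinal.lift_natCast] at h
    rw [hd]
    have h' : Nat.card G + d = Nat.card Gt := by exact_mod_cast h
    exact_mod_cast (by omega : s.card ≤ d)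


/-- Theorem 1.8 (second case): if `char K = p > 0` and `1 → H → G̃ → G → 1` is a group
extension of finite groups with `H` an abelian `p`-group lying in the center of `G̃`, then
there is a `K`-embedding of `K(G)` into `K(G̃)` making `K(G̃)` rational over (the image of)
`K(G)`. -/
theorem noether_rational_central_abelian_p_kernel
    (K : Type*) [Field K] (p : ℕ) (hp : p.Prime) [CharP K p]
    (Gt G : Type*) [Group Gt] [Group G] [Finite Gt] [Finite G]
    (π : Gt →* G) (hsurj : Function.Surjective π)
    (hp_ker : IsPGroup p π.ker) (hcentral : π.ker ≤ Subgroup.center Gt) :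
    ∃ ι : NoetherField K G →ₐ[K] NoetherField K Gt,
      @IsRationalExtension (NoetherField K G) (NoetherField K Gt) _ _
        ι.toRingHom.toAlgebra := by
  exact noether_final K Gt G (good_all K p hp _ Gt π hsurj hp_ker hcentral rfl)

end
end

section
/- Let K be any field and H, G finite groups. If K(H) is stably rational over K, then there exists a K-embedding ι : K(G) → K(H × G) such that K(H × G) is stably rational over the subfield ι(K(G)). In particular, if both K(H) and K(G) are stably rational over K, then K(H × G) is stably rational over K. -/
set_option synthInstance.maxHeartbeats 1000000
set_option maxHeartbeats 1000000

noncomputable section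

set_option linter.style.haveILetI false

/-! ### generic lemmas -/

lemma aux_trdeg_alg {K F N : Type*} [Field K] [Field F] [Field N] [Algebra K F] [Algebra F N]
    [Algebra K N] [IsScalarTower K F N] [Algebra.IsAlgebraic F N] (b : ℕ)
    (hN : Algebra.trdeg K N = b) : Algebra.trdeg K F = b := by
  have h := lift_trdeg_add_eq K F N
  rw [trdeg_eq_zero (R := F) (A := N), hN] at h
  simpa using h

open scoped IntermediateField.algebraAdjoinAdjoin in
lemma aux_algInd {K F Ω ι : Type*} [Field K] [Field F] [Field Ω] [Algebra K F] [Algebra F Ω]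
    [Algebra K Ω] [IsScalarTower K F Ω] [Finite ι] (w : ι → Ω) (a b : ℕ)
    (hF : Algebra.trdeg K F = a) (hΩ : Algebra.trdeg K Ω = b)
    (halg : Algebra.IsAlgebraic (IntermediateField.adjoin F (Set.range w)) Ω)
    (hc : a + Nat.card ι ≤ b) : AlgebraicIndependent F w := by
  have h := lift_trdeg_add_eq K F Ω
  rw [hF, hΩ] at h
  simp only [Cardinal.lift_natCast] at h
  have halg' : Algebra.IsAlgebraic (Algebra.adjoin F (Set.range w)) Ω := by
    have : IsFractionRing (Algebra.adjoin F (Set.range w))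
      (IntermediateField.adjoin F (Set.range w)) := inferInstance
    exact (IsFractionRing.comap_isAlgebraic_iff (A := Algebra.adjoin F (Set.range w))
      (K := IntermediateField.adjoin F (Set.range w)) (C := Ω)).mpr halg
  refine (Algebra.IsAlgebraic.isTranscendenceBasis_of_lift_le_trdeg_of_finite F w ?_).1
  have hlt : Algebra.trdeg F Ω < Cardinal.aleph0 := by
    rw [← Cardinal.lift_lt_aleph0]
    refine lt_of_le_of_lt (self_le_add_left _ _) (h.trans_lt (Cardinal.natCast_lt_aleph0))
  obtain ⟨c, hc'⟩ := Cardinal.lt_aleph0.mp hlt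
  rw [hc'] at h ⊢
  have : a + c = b := by
    simp only [Cardinal.lift_natCast] at h
    exact_mod_cast h
  have h2 : Nat.card ι ≤ c := by omega
  haveI := Fintype.ofFinite ι
  simp only [Cardinal.mk_fintype, Cardinal.lift_natCast]
  rw [Nat.card_eq_fintype_card] at h2
  exact_mod_cast h2

/-- generic descent -/
lemma aux_descent {Γ M Ω : Type*} [Group Γ] [Finite Γ] [Field M] [Field Ω] [Algebra M Ω]
    {K : Type*} [Field K] [Algebra K Ω]
    (ρ : Γ →* (Ω ≃ₐ[K] Ω)) (σ : Γ → (M →+* M)) (hσ : Function.Injective σ)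
    (hc : ∀ γ m, algebraMap M Ω (σ γ m) = ρ γ (algebraMap M Ω m))
    (A : Submodule M Ω) (hA : ∀ γ, ∀ a ∈ A, ρ γ a ∈ A) :
    A ≤ Submodule.span M {a | a ∈ A ∧ ∀ γ, ρ γ a = a} := by
  haveI := Fintype.ofFinite Γ
  intro a ha
  by_contra hn
  obtain ⟨f, hf1, hf2⟩ := Submodule.exists_le_ker_of_notMem hn
  have key : ∀ θ : M, ∑ γ, f (ρ γ a) * σ γ θ = 0 := by
    intro θ
    have hmem : (∑ γ, ρ γ (θ • a)) ∈ Submodule.span M {a | a ∈ A ∧ ∀ γ, ρ γ a = a} := by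
      refine Submodule.subset_span ⟨A.sum_mem fun γ _ => hA γ _ (A.smul_mem _ ha), fun δ => ?_⟩
      rw [map_sum]
      refine Fintype.sum_equiv (Equiv.mulLeft δ) _ _ (fun γ => ?_)
      simp
    have := hf2 hmem
    rw [LinearMap.mem_ker, map_sum] at this
    rw [← this]
    refine Finset.sum_congr rfl fun γ _ => ?_
    rw [Algebra.smul_def, map_mul, ← hc, ← Algebra.smul_def, map_smul, smul_eq_mul, mul_comm]
  have hli := (linearIndependent_monoidHom M M).comp (fun γ : Γ => (σ γ : M →* M))
    (fun γ δ h => hσ (RingHom.ext fun m => DFunLike.congr_fun h m))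
  rw [Fintype.linearIndependent_iff] at hli
  have := hli (fun γ => f (ρ γ a)) (by ext θ; simpa using key θ) 1
  apply hf1
  simpa using this

lemma aux_descent' {Γ M Ω : Type*} [Group Γ] [Finite Γ] [Field M] [Field Ω] [Algebra M Ω]
    {K : Type*} [Field K] [Algebra K Ω]
    (ρ : Γ →* (Ω ≃ₐ[K] Ω)) (σ : Γ → (M →+* M)) (hσ : Function.Injective σ)
    (hc : ∀ γ m, algebraMap M Ω (σ γ m) = ρ γ (algebraMap M Ω m))
    (S : Set Ω) (hS : S.Finite) (hA : ∀ γ, ∀ a ∈ S, ρ γ a ∈ Submodule.span M (insert 1 S)) (m : ℕ)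
    (hm : S.ncard ≤ m) :
    ∃ u : Fin m → Ω, (∀ i γ, ρ γ (u i) = u i) ∧
      S ⊆ IntermediateField.adjoin M (Set.range u) := by
  classical
  set A := Submodule.span M (insert 1 S) with hAdef
  have hstab : ∀ γ, ∀ a ∈ A, ρ γ a ∈ A := by
    intro γ a ha
    induction ha using Submodule.span_induction with
    | mem x hx =>
      rcases hx with rfl | hx
      · rw [map_one]; exact Submodule.subset_span (Set.mem_insert _ _)
      · exact hA γ x hx
    | zero => simp
    | add x y _ _ hx hy => rw [map_add]; exact A.add_mem hx hy
    | smul c x _ hx =>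
      rw [Algebra.smul_def, map_mul, ← hc, ← Algebra.smul_def]; exact A.smul_mem _ hx
  have hd := aux_descent ρ σ hσ hc A hstab
  set T := {a | a ∈ A ∧ ∀ γ, ρ γ a = a} with hT
  have h1T : ({1} : Set Ω) ⊆ T := by
    rintro _ rfl
    exact ⟨Submodule.subset_span (Set.mem_insert _ _), fun γ => map_one _⟩
  have hli1 : LinearIndepOn M id ({1} : Set Ω) := LinearIndepOn.singleton (by simp)
  obtain ⟨B, hBT, h1B, hTB, hB⟩ := exists_linearIndepOn_id_extension hli1 h1T
  have hBA : B ⊆ A := fun x hx => (hBT hx).1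
  haveI : FiniteDimensional M A :=
    FiniteDimensional.span_of_finite M (hS.insert 1)
  have hfr : Module.finrank M A ≤ m + 1 := by
    have h1 : Module.finrank M A ≤ (insert 1 S).ncard := by
      have := (hS.insert 1).fintype
      have h := finrank_span_le_card (R := M) (insert 1 S)
      rwa [← Set.ncard_eq_toFinset_card'] at h
    have := Set.ncard_insert_le 1 S
    omega
  have hB' : LinearIndependent M (fun b : B => (⟨b, hBA b.2⟩ : A)) := by
    apply LinearIndependent.of_comp A.subtype
    exact hB
  have hBfin : B.Finite := by
    have := hB'.finite
    exact Set.toFinite B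
  have hBc : B.ncard ≤ m + 1 := by
    have := hBfin.fintype
    have h := hB'.fintype_card_le_finrank
    rw [← Nat.card_eq_fintype_card, Nat.card_coe_set_eq] at h
    omega
  have h1B' : (1 : Ω) ∈ B := h1B rfl
  set C := B \ {1} with hC
  have hCfin : C.Finite := hBfin.sdiff
  have hCc : C.ncard ≤ m := by
    have := Set.ncard_sdiff_singleton_add_one h1B' hBfin
    rw [← hC] at this
    omega
  haveI := hCfin.fintype
  have hle : Fintype.card C ≤ Fintype.card (Fin m) := by
    rw [← Nat.card_eq_fintype_card, Nat.card_coe_set_eq]; simpa using hCc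
  obtain ⟨e⟩ := Function.Embedding.nonempty_of_card_le hle
  let u : Fin m → Ω := fun i => if h : ∃ c : C, e c = i then (h.choose : Ω) else 1
  have hu : ∀ c : C, u (e c) = c := by
    intro c
    have h : ∃ c' : C, e c' = e c := ⟨c, rfl⟩
    simp only [u, dif_pos h]
    congr 1
    exact e.injective h.choose_spec
  refine ⟨u, fun i γ => ?_, fun s hs => ?_⟩
  · simp only [u]
    split_ifs with h
    · exact (hBT h.choose.2.1).2 γ
    · exact map_one _
  · have hs1 : s ∈ Submodule.span M T := hd (Submodule.subset_span (Set.mem_insert_of_mem _ hs))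
    have hs2 : s ∈ Submodule.span M B := Submodule.span_le.mpr hTB hs1
    have hle : Submodule.span M B ≤
        Subalgebra.toSubmodule (IntermediateField.adjoin M (Set.range u)).toSubalgebra := by
      rw [Submodule.span_le]
      intro b hb
      by_cases hb1 : b = 1
      · subst hb1; exact one_mem (IntermediateField.adjoin M (Set.range u))
      · have : b ∈ Set.range u := ⟨e ⟨b, hb, hb1⟩, hu _⟩
        exact IntermediateField.subset_adjoin M _ this
    exact hle hs2

/-- degree lemma -/
lemma aux_rank {F N Q Ω : Type*} [Field F] [Field N] [Field Q] [Field Ω] [Algebra F N]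
    [Algebra Q Ω] (φ : N →+* Ω) (n : ℕ) [FiniteDimensional F N] (hn : Module.finrank F N = n)
    (hF : ∀ a : F, φ (algebraMap F N a) ∈ Set.range (algebraMap Q Ω)) :
    Module.rank Q (IntermediateField.adjoin Q (Set.range φ)) ≤ n := by
  letI i1 : Algebra F Ω := (φ.comp (algebraMap F N)).toAlgebra
  choose g hg using hF
  let gh : F →+* Q :=
    { toFun := g
      map_one' := (algebraMap Q Ω).injective (by rw [hg]; simp)
      map_zero' := (algebraMap Q Ω).injective (by rw [hg]; simp)
      map_add' := fun a b => (algebraMap Q Ω).injective (by rw [map_add, hg, hg, hg]; simp)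
      map_mul' := fun a b => (algebraMap Q Ω).injective (by rw [map_mul, hg, hg, hg]; simp) }
  letI i2 : Algebra F Q := gh.toAlgebra
  haveI : IsScalarTower F Q Ω := IsScalarTower.of_algebraMap_eq fun a => (hg a).symm
  let φ' : N →ₐ[F] Ω := { φ with commutes' := fun a => rfl }
  let L : IntermediateField F Ω := φ'.fieldRange
  have e : N ≃ₐ[F] L := AlgEquiv.ofInjectiveField φ'
  haveI : FiniteDimensional F L := Module.Finite.equiv e.toLinearEquiv
  have h := IntermediateField.adjoin_rank_le_of_isAlgebraic_right Q L
  have hL : (L : Set Ω) = Set.range φ := by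
    ext x; rfl
  rw [hL] at h
  refine h.trans ?_
  rw [← Module.finrank_eq_rank, ← e.toLinearEquiv.finrank_eq, hn]

/-- Artin bound -/
lemma aux_artin {Γ Q Ω : Type*} [Group Γ] [Finite Γ] [Field Q] [Field Ω] [Algebra Q Ω]
    {K : Type*} [Field K] [Algebra K Ω]
    (ρ : Γ →* (Ω ≃ₐ[K] Ω)) (hρ : Function.Injective ρ)
    (hQ : ∀ γ q, ρ γ (algebraMap Q Ω q) = algebraMap Q Ω q)
    (hr : Module.rank Q Ω ≤ (Nat.card Γ : ℕ)) :
    Set.range (algebraMap Q Ω) = {x | ∀ γ, ρ γ x = x} := by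
  haveI := Fintype.ofFinite Γ
  letI : MulSemiringAction Γ Ω := MulSemiringAction.compHom Ω ρ
  have hsm : ∀ (γ : Γ) (x : Ω), γ • x = ρ γ x := fun _ _ => rfl
  haveI : FaithfulSMul Γ Ω := ⟨fun {a b} h => hρ (AlgEquiv.ext h)⟩
  have hcard := FixedPoints.finrank_eq_card Γ Ω
  let R := FixedPoints.subfield Γ Ω
  have hmem : ∀ x, x ∈ R ↔ ∀ γ, ρ γ x = x := fun x => Iff.rfl
  let j : Q →+* R := (algebraMap Q Ω).codRestrict R (fun q => (hmem _).2 fun γ => hQ γ q)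
  letI : Algebra Q R := j.toAlgebra
  haveI : IsScalarTower Q R Ω := IsScalarTower.of_algebraMap_eq fun a => rfl
  haveI : FiniteDimensional Q Ω := by
    rw [FiniteDimensional, ← Module.rank_lt_aleph0_iff]
    exact hr.trans_lt Cardinal.natCast_lt_aleph0
  haveI : FiniteDimensional Q R := FiniteDimensional.left Q R Ω
  have hfr : Module.finrank Q Ω ≤ Nat.card Γ := by
    rw [← Module.finrank_eq_rank] at hr
    exact_mod_cast hr
  have hmul := Module.finrank_mul_finrank Q R Ω
  rw [Nat.card_eq_fintype_card] at hfr
  have hpos : 0 < Fintype.card Γ := Fintype.card_pos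
  have h1 : Module.finrank Q R = 1 := by
    have hp : 0 < Module.finrank Q R := Module.finrank_pos
    have : Module.finrank Q R * Fintype.card Γ ≤ 1 * Fintype.card Γ := by
      rw [← hcard, one_mul, hmul, hcard]; exact hfr
    have := Nat.le_of_mul_le_mul_right this hpos
    omega
  have hsurj : Function.Surjective (algebraMap Q R) := by
    intro x
    have : (⊤ : Subalgebra Q R) = ⊥ := (Subalgebra.bot_eq_top_iff_finrank_eq_one.mpr h1).symm
    have hx : x ∈ (⊤ : Subalgebra Q R) := trivial
    rw [this] at hx
    exact hx
  ext x
  constructor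
  · rintro ⟨q, rfl⟩ γ
    exact hQ γ q
  · intro hx
    obtain ⟨q, hq⟩ := hsurj ⟨x, (hmem x).2 hx⟩
    exact ⟨q, congrArg Subtype.val hq⟩

/-- final comparison -/
lemma aux_final {k P Ω : Type*} [Field k] [Field P] [Field Ω] [Algebra k P] [Algebra P Ω]
    [Algebra k Ω] [IsScalarTower k P Ω] {m n : ℕ} (u : Fin m → Ω) (w : Fin n → Ω)
    (hu : AlgebraicIndependent P u) (hw : AlgebraicIndependent k w)
    (h : (IntermediateField.adjoin P (Set.range u) : Set Ω) =
      IntermediateField.adjoin k (Set.range w)) : IsStablyRationalExtension k P := by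
  refine ⟨m, n, ⟨?_⟩⟩
  have h' : (IntermediateField.adjoin P (Set.range u)).restrictScalars k =
      IntermediateField.adjoin k (Set.range w) := SetLike.coe_injective h
  have e1 := hu.aevalEquivField.restrictScalars k
  have e2 := hw.aevalEquivField
  exact (e1.trans (IntermediateField.equivOfEq h' : _)).trans e2.symm

/-! ### rational function fields -/

/-- the variables -/
def xv (F : Type*) [Field F] {σ : Type*} (i : σ) : FractionRing (MvPolynomial σ F) :=
  algebraMap (MvPolynomial σ F) _ (MvPolynomial.X i)

lemma frac_mem {F σ Ω : Type*} [Field F] [Field Ω] (f : FractionRing (MvPolynomial σ F) →+* Ω)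
    (L : Subfield Ω) (hC : ∀ c : F, f (algebraMap F _ c) ∈ L) (hX : ∀ i, f (xv F i) ∈ L) (d) :
    f d ∈ L := by
  have hp : ∀ p : MvPolynomial σ F, f (algebraMap _ _ p) ∈ L := by
    intro p
    induction p using MvPolynomial.induction_on with
    | C a =>
      have := hC a
      rwa [IsScalarTower.algebraMap_apply F (MvPolynomial σ F)] at this
    | add p q hp hq => rw [map_add, map_add]; exact L.add_mem hp hq
    | mul_X p i hp => rw [map_mul, map_mul]; exact L.mul_mem hp (hX i)
  obtain ⟨a, b, _, rfl⟩ := IsFractionRing.div_surjective (A := MvPolynomial σ F) d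
  rw [map_div₀]
  exact L.div_mem (hp a) (hp b)

lemma frac_ext {F σ Ω : Type*} [Field F] [Field Ω] (f g : FractionRing (MvPolynomial σ F) →+* Ω)
    (hC : ∀ c : F, f (algebraMap F _ c) = g (algebraMap F _ c))
    (hX : ∀ i, f (xv F i) = g (xv F i)) : f = g := by
  have hp : ∀ p : MvPolynomial σ F, f (algebraMap _ _ p) = g (algebraMap _ _ p) := by
    intro p
    induction p using MvPolynomial.induction_on with
    | C a =>
      have := hC a
      rwa [IsScalarTower.algebraMap_apply F (MvPolynomial σ F)] at this
    | add p q hp hq => simp only [map_add, hp, hq]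
    | mul_X p i hp =>
      have := hX i
      simp only [xv] at this
      simp only [map_mul, hp, this]
  ext d
  obtain ⟨a, b, _, rfl⟩ := IsFractionRing.div_surjective (A := MvPolynomial σ F) d
  simp only [map_div₀, hp]

lemma xv_algInd (F : Type*) [Field F] (σ : Type*) :
    AlgebraicIndependent F (xv F : σ → FractionRing (MvPolynomial σ F)) :=
  (MvPolynomial.algebraicIndependent_X σ F).map' (f := IsScalarTower.toAlgHom F (MvPolynomial σ F)
    (FractionRing (MvPolynomial σ F))) (IsFractionRing.injective _ _)

lemma xv_adjoin (F : Type*) [Field F] (σ : Type*) :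
    IntermediateField.adjoin F (Set.range (xv F : σ → FractionRing (MvPolynomial σ F))) = ⊤ := by
  rw [eq_top_iff]
  intro d _
  refine frac_mem (RingHom.id _) (IntermediateField.adjoin F
    (Set.range (xv F : σ → FractionRing (MvPolynomial σ F)))).toSubfield (fun c => ?_)
    (fun i => ?_) d
  · exact IntermediateField.algebraMap_mem _ c
  · exact IntermediateField.subset_adjoin F _ ⟨i, rfl⟩

lemma trdeg_of_gen {F Ω σ : Type*} [Field F] [Field Ω] [Algebra F Ω] [Finite σ] (x : σ → Ω)
    (hx : AlgebraicIndependent F x) (hg : IntermediateField.adjoin F (Set.range x) = ⊤) :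
    Algebra.trdeg F Ω = Nat.card σ := by
  haveI := Fintype.ofFinite σ
  have h : IsTranscendenceBasis F x := by
    rw [hx.isTranscendenceBasis_iff_isAlgebraic]
    have halg : Algebra.IsAlgebraic (IntermediateField.adjoin F (Set.range x)) Ω := by
      rw [hg]
      exact ⟨fun a => isAlgebraic_algebraMap (A := Ω) (⟨a, trivial⟩ : (⊤ : IntermediateField F Ω))⟩
    open scoped IntermediateField.algebraAdjoinAdjoin in
    exact (IsFractionRing.comap_isAlgebraic_iff (A := Algebra.adjoin F (Set.range x))
      (K := IntermediateField.adjoin F (Set.range x)) (C := Ω)).mpr halg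
  have := h.lift_cardinalMk_eq_trdeg
  rw [Cardinal.mk_fintype, Cardinal.lift_natCast] at this
  rw [Nat.card_eq_fintype_card]
  symm at this
  simpa using this

lemma frac_trdeg (F : Type*) [Field F] (σ : Type*) [Finite σ] :
    Algebra.trdeg F (FractionRing (MvPolynomial σ F)) = Nat.card σ :=
  trdeg_of_gen _ (xv_algInd F σ) (xv_adjoin F σ)

lemma exists_frac_lift {F Ω σ : Type*} [Field F] [Field Ω] [Algebra F Ω] (x : σ → Ω)
    (hx : AlgebraicIndependent F x) :
    ∃ φ : FractionRing (MvPolynomial σ F) →ₐ[F] Ω, ∀ i, φ (xv F i) = x i := by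
  refine ⟨(IntermediateField.val _).comp hx.aevalEquivField.toAlgHom, fun i => ?_⟩
  simp [xv]

lemma adjoin_mem {F Ω : Type*} [Field F] [Field Ω] [Algebra F Ω] (S : Set Ω) (L : Subfield Ω)
    (hF : ∀ c, algebraMap F Ω c ∈ L) (hS : ∀ s ∈ S, s ∈ L) (a : Ω)
    (ha : a ∈ IntermediateField.adjoin F S) : a ∈ L := by
  have h : (IntermediateField.adjoin F S).toSubfield ≤ L := by
    rw [IntermediateField.adjoin_toSubfield, Subfield.closure_le]
    rintro y (⟨c, rfl⟩ | hy)
    · exact hF c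
    · exact hS y hy
  exact h ha

/-! ### Noether fields -/

lemma noetherAut_xv (K : Type*) [Field K] (G : Type*) [Group G] (h g : G) :
    noetherAut K G h (xv K g) = xv K (h * g) := by
  simp [noetherAut, xv]

lemma noetherAut_mul (K : Type*) [Field K] (G : Type*) [Group G] (h g : G) :
    noetherAut K G (h * g) = noetherAut K G h * noetherAut K G g := by
  have := frac_ext (noetherAut K G (h * g) : NoetherBigField K G →+* NoetherBigField K G)
    ((noetherAut K G h * noetherAut K G g : NoetherBigField K G ≃ₐ[K] NoetherBigField K G) :
      NoetherBigField K G →+* NoetherBigField K G) (fun c => ?_) (fun i => ?_)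
  · ext a
    exact DFunLike.congr_fun this a
  · simp
  · simp [noetherAut_xv, mul_assoc]

def noetherHom (K : Type*) [Field K] (G : Type*) [Group G] :
    G →* (NoetherBigField K G ≃ₐ[K] NoetherBigField K G) :=
  MonoidHom.mk' (noetherAut K G) (noetherAut_mul K G)

lemma noetherAut_inj (K : Type*) [Field K] (G : Type*) [Group G] :
    Function.Injective (noetherAut K G) := by
  intro a b h
  have := DFunLike.congr_fun h (xv K 1)
  rw [noetherAut_xv, noetherAut_xv] at this
  simpa using (xv_algInd K G).injective this

/-- inclusion -/
def noetherIncl (K : Type*) [Field K] (G : Type*) [Group G] :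
    NoetherField K G →ₐ[K] NoetherBigField K G :=
  { (noetherSubfield K G).subtype with commutes' := fun _ => rfl }

lemma noetherIncl_inj (K : Type*) [Field K] (G : Type*) [Group G] :
    Function.Injective (noetherIncl K G) := (noetherIncl K G).toRingHom.injective

lemma noetherIncl_fixed (K : Type*) [Field K] (G : Type*) [Group G] (a : NoetherField K G) (g : G) :
    noetherAut K G g (noetherIncl K G a) = noetherIncl K G a := a.2 g

lemma noetherIncl_surj (K : Type*) [Field K] (G : Type*) [Group G] (b : NoetherBigField K G)
    (hb : ∀ g, noetherAut K G g b = b) : ∃ a, noetherIncl K G a = b := ⟨⟨b, hb⟩, rfl⟩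

@[reducible] def noetherAlg (K : Type*) [Field K] (G : Type*) [Group G] :
    Algebra (NoetherField K G) (NoetherBigField K G) := (noetherIncl K G).toRingHom.toAlgebra

section NoetherMain

attribute [local instance] noetherAlg

lemma noether_tower (K : Type*) [Field K] (G : Type*) [Group G] :
    IsScalarTower K (NoetherField K G) (NoetherBigField K G) :=
  IsScalarTower.of_algebraMap_eq fun _ => rfl

lemma noether_fin (K : Type*) [Field K] (G : Type*) [Group G] [Finite G] :
    FiniteDimensional (NoetherField K G) (NoetherBigField K G) ∧
    Module.finrank (NoetherField K G) (NoetherBigField K G) = Nat.card G := by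
  haveI := Fintype.ofFinite G
  letI : MulSemiringAction G (NoetherBigField K G) :=
    MulSemiringAction.compHom (NoetherBigField K G) (noetherHom K G)
  haveI : FaithfulSMul G (NoetherBigField K G) :=
    ⟨fun {a b} h => noetherAut_inj K G (AlgEquiv.ext h)⟩
  have h1 : FiniteDimensional (FixedPoints.subfield G (NoetherBigField K G)) (NoetherBigField K G) :=
    inferInstance
  have h2 := FixedPoints.finrank_eq_card G (NoetherBigField K G)
  rw [Nat.card_eq_fintype_card]
  exact ⟨h1, h2⟩

lemma noether_trdeg (K : Type*) [Field K] (G : Type*) [Group G] [Finite G] :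
    Algebra.trdeg K (NoetherField K G) = Nat.card G := by
  haveI := (noether_fin K G).1
  haveI := noether_tower K G
  exact aux_trdeg_alg (N := NoetherBigField K G) _ (frac_trdeg K G)


lemma rank_of_top {Q Ω : Type*} [Field Q] [Field Ω] [Algebra Q Ω] (L : IntermediateField Q Ω)
    (hL : L = ⊤) (c : Cardinal) (h : Module.rank Q L ≤ c) : Module.rank Q Ω ≤ c := by
  subst hL
  rwa [← (IntermediateField.topEquiv (F := Q) (E := Ω)).toLinearEquiv.rank_eq]

lemma alg_of_rank {Q Ω : Type*} [Field Q] [Field Ω] [Algebra Q Ω] (n : ℕ)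
    (h : Module.rank Q Ω ≤ n) : Algebra.IsAlgebraic Q Ω := by
  haveI : FiniteDimensional Q Ω := by
    rw [FiniteDimensional, ← Module.rank_lt_aleph0_iff]
    exact h.trans_lt Cardinal.natCast_lt_aleph0
  infer_instance

/-- fixed subfield -/
def fixedSub {Γ K Ω : Type*} [Group Γ] [Field K] [Field Ω] [Algebra K Ω]
    (ρ : Γ →* (Ω ≃ₐ[K] Ω)) : Subfield Ω where
  carrier := {x | ∀ h : Γ, ρ h x = x}
  mul_mem' := by intro a b ha hb h; rw [map_mul, ha h, hb h]
  one_mem' := by intro h; rw [map_one]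
  add_mem' := by intro a b ha hb h; rw [map_add, ha h, hb h]
  zero_mem' := by intro h; rw [map_zero]
  neg_mem' := by intro a ha h; rw [map_neg, ha h]
  inv_mem' := by intro a ha h; rw [map_inv₀, ha h]

lemma part_common {Γ K P Ω : Type*} [Group Γ] [Finite Γ] [Field K] [Field P] [Field Ω]
    [Algebra K P] [Algebra K Ω] [Algebra P Ω] [IsScalarTower K P Ω]
    (ρ : Γ →* (Ω ≃ₐ[K] Ω)) (hρ : Function.Injective ρ)
    (hP : ∀ γ p, ρ γ (algebraMap P Ω p) = algebraMap P Ω p)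
    {m : ℕ} (u : Fin m → Ω) (hu : ∀ i γ, ρ γ (u i) = u i) (a b : ℕ)
    (ha : Algebra.trdeg K P = a) (hb : Algebra.trdeg K Ω = b) (hab : a + m ≤ b)
    (hr : Module.rank (IntermediateField.adjoin P (Set.range u)) Ω ≤ (Nat.card Γ : ℕ)) :
    AlgebraicIndependent P u ∧
      (IntermediateField.adjoin P (Set.range u) : Set Ω) = fixedSub ρ := by
  constructor
  · refine aux_algInd (K := K) u _ _ ha hb (alg_of_rank _ hr) ?_
    simpa using hab
  · have := aux_artin ρ hρ (Q := IntermediateField.adjoin P (Set.range u)) ?_ hr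
    · refine Eq.trans ?_ this
      ext x; simp
    · rintro γ ⟨q, hq⟩
      exact adjoin_mem (Set.range u) (fixedSub ρ) (fun c γ => hP γ c)
        (by rintro _ ⟨i, rfl⟩ γ; exact hu i γ) q hq γ

lemma partI_abs {Γ K P B Ω : Type*} [Group Γ] [Finite Γ] [Field K] [Field P] [Field B] [Field Ω]
    [Algebra K P] [Algebra K Ω] [Algebra P B] [Algebra B Ω] [Algebra P Ω] [IsScalarTower P B Ω]
    [IsScalarTower K P Ω] [FiniteDimensional P B] (hfr : Module.finrank P B = Nat.card Γ)
    (ρ : Γ →* (Ω ≃ₐ[K] Ω)) (hρ : Function.Injective ρ)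
    (hP : ∀ γ p, ρ γ (algebraMap P Ω p) = algebraMap P Ω p)
    (σ : Γ → (B →+* B)) (hσ : Function.Injective σ)
    (hc : ∀ γ m, algebraMap B Ω (σ γ m) = ρ γ (algebraMap B Ω m))
    (S : Set Ω) (hS : S.Finite) (hA : ∀ γ, ∀ a ∈ S, ρ γ a ∈ S) (m : ℕ)
    (hm : S.ncard ≤ m) (a b : ℕ)
    (ha : Algebra.trdeg K P = a) (hb : Algebra.trdeg K Ω = b) (hab : a + m ≤ b)
    (hgen : ∀ L : Subfield Ω, (∀ c, algebraMap B Ω c ∈ L) → (∀ s ∈ S, s ∈ L) → ∀ x, x ∈ L) :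
    ∃ u : Fin m → Ω, AlgebraicIndependent P u ∧
      (IntermediateField.adjoin P (Set.range u) : Set Ω) = fixedSub ρ := by
  obtain ⟨u, hu, hSu⟩ := aux_descent' ρ σ hσ hc S hS
    (fun γ a ha => Submodule.subset_span (Set.mem_insert_of_mem _ (hA γ a ha))) m hm
  refine ⟨u, part_common ρ hρ hP u hu a b ha hb hab ?_⟩
  set Q := IntermediateField.adjoin P (Set.range u) with hQ
  have htop : IntermediateField.adjoin Q (Set.range (algebraMap B Ω)) = ⊤ := by
    rw [eq_top_iff]
    intro x _
    have hx : ∀ b, algebraMap B Ω b ∈ IntermediateField.adjoin Q (Set.range (algebraMap B Ω)) :=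
      fun b => IntermediateField.subset_adjoin Q _ ⟨b, rfl⟩
    have hu' : ∀ i, u i ∈ IntermediateField.adjoin Q (Set.range (algebraMap B Ω)) := fun i =>
      IntermediateField.algebraMap_mem _
        (⟨u i, IntermediateField.subset_adjoin _ _ ⟨i, rfl⟩⟩ : Q)
    refine hgen (IntermediateField.adjoin Q (Set.range (algebraMap B Ω))).toSubfield hx
      (fun s hs => ?_) x
    exact adjoin_mem (F := B) (Set.range u)
        (IntermediateField.adjoin Q (Set.range (algebraMap B Ω))).toSubfield hx
        (by rintro _ ⟨i, rfl⟩; exact hu' i) _ (hSu hs)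
  refine rank_of_top _ htop _ (aux_rank (F := P) (algebraMap B Ω) _ hfr (fun a =>
    ⟨algebraMap P Q a, ?_⟩))
  rw [← IsScalarTower.algebraMap_apply, ← IsScalarTower.algebraMap_apply]

lemma partII_abs {Γ K k Y E Z Ω : Type*} [Group Γ] [Finite Γ] [Field K] [Field k] [Field Y]
    [Field E] [Field Z] [Field Ω] [Algebra K k] [Algebra K Ω] [Algebra k Ω]
    [Algebra k Y] [Algebra E Z] [IsScalarTower K k Ω] [FiniteDimensional k Y]
    [FiniteDimensional E Z]
    (hfr : Module.finrank k Y * Module.finrank E Z = Nat.card Γ)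
    (φy : Y →+* Ω) (φz : Z →+* Ω) (hk : ∀ a, algebraMap k Ω a = φy (algebraMap k Y a))
    (ρ : Γ →* (Ω ≃ₐ[K] Ω)) (hρ : Function.Injective ρ)
    (hP : ∀ γ p, ρ γ (algebraMap k Ω p) = algebraMap k Ω p)
    {m : ℕ} (w : Fin m → Ω) (hw : ∀ i γ, ρ γ (w i) = w i)
    (hE : ∀ a : E, φz (algebraMap E Z a) ∈ IntermediateField.adjoin K (Set.range w))
    (a b : ℕ) (ha : Algebra.trdeg K k = a) (hb : Algebra.trdeg K Ω = b) (hab : a + m ≤ b)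
    (hgen : ∀ L : Subfield Ω, (∀ c, φy c ∈ L) → (∀ c, φz c ∈ L) → (∀ i, w i ∈ L) → ∀ x, x ∈ L) :
    AlgebraicIndependent k w ∧
      (IntermediateField.adjoin k (Set.range w) : Set Ω) = fixedSub ρ := by
  refine part_common ρ hρ hP w hw a b ha hb hab ?_
  set Q := IntermediateField.adjoin k (Set.range w) with hQ
  have r1 : Module.rank Q (IntermediateField.adjoin Q (Set.range φy)) ≤
      (Module.finrank k Y : ℕ) :=
    aux_rank (F := k) φy _ rfl (fun a => ⟨algebraMap k Q a, hk a⟩)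
  set Q' := IntermediateField.adjoin Q (Set.range φy) with hQ'
  have hyQ' : ∀ c, φy c ∈ Q' := fun c => IntermediateField.subset_adjoin Q _ ⟨c, rfl⟩
  have hwQ' : ∀ i, w i ∈ Q' := fun i => IntermediateField.algebraMap_mem _
        (⟨w i, IntermediateField.subset_adjoin _ _ ⟨i, rfl⟩⟩ : Q)
  have hkQ' : ∀ c, algebraMap k Ω c ∈ Q' := fun c => by rw [hk]; exact hyQ' _
  have r2 : Module.rank Q' (IntermediateField.adjoin Q' (Set.range φz)) ≤
      (Module.finrank E Z : ℕ) := by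
    refine aux_rank (F := E) φz _ rfl (fun a => ?_)
    have : φz (algebraMap E Z a) ∈ Q' := by
      refine adjoin_mem (Set.range w) Q'.toSubfield (fun c => ?_) ?_ _ (hE a)
      · rw [IsScalarTower.algebraMap_apply K k Ω]; exact hkQ' _
      · rintro _ ⟨i, rfl⟩; exact hwQ' i
    exact ⟨⟨_, this⟩, rfl⟩
  have htop : IntermediateField.adjoin Q' (Set.range φz) = ⊤ := by
    rw [eq_top_iff]
    intro x _
    refine hgen (IntermediateField.adjoin Q' (Set.range φz)).toSubfield (fun c => ?_) (fun c => ?_)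
      (fun i => ?_) x
    · exact IntermediateField.algebraMap_mem _ (⟨_, hyQ' c⟩ : Q')
    · exact IntermediateField.subset_adjoin Q' _ ⟨c, rfl⟩
    · exact IntermediateField.algebraMap_mem _ (⟨_, hwQ' i⟩ : Q')
  have r3 := rank_of_top _ htop _ r2
  rw [← rank_mul_rank Q Q' Ω, ← hfr, Nat.cast_mul]
  exact mul_le_mul' r1 r3

/-- the elements `v` over `K(y, z, t)`: affine version -/
lemma descent_sub {Γ K Ω : Type*} [Group Γ] [Finite Γ] [Field K] [Field Ω] [Algebra K Ω]
    (ρ : Γ →* (Ω ≃ₐ[K] Ω)) (T : Set Ω) (hT : ∀ γ, ∀ a ∈ T, ρ γ a ∈ T)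
    (hinj : ∀ γ δ, (∀ a ∈ T, ρ γ a = ρ δ a) → γ = δ)
    (S : Set Ω) (hS : S.Finite)
    (hA : ∀ γ, ∀ a ∈ S, ρ γ a ∈ Submodule.span K (S ∪ T))
    (m : ℕ) (hm : S.ncard ≤ m) :
    ∃ v : Fin m → Ω, (∀ i γ, ρ γ (v i) = v i) ∧
      ∀ L : Subfield Ω, (∀ c, algebraMap K Ω c ∈ L) → (∀ a ∈ T, a ∈ L) → (∀ i, v i ∈ L) →
        ∀ s ∈ S, s ∈ L := by
  let M := IntermediateField.adjoin K T
  have hTM : ∀ a ∈ T, a ∈ M := fun a ha => IntermediateField.subset_adjoin K _ ha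
  have hst : ∀ γ, ∀ a ∈ M, ρ γ a ∈ M := by
    intro γ a ha
    refine adjoin_mem T (M.toSubfield.comap (ρ γ : Ω →+* Ω)) (fun c => ?_) (fun s hs => ?_) a ha
    · change ρ γ (algebraMap K Ω c) ∈ M
      rw [AlgEquiv.commutes]; exact M.algebraMap_mem c
    · exact hTM _ (hT γ s hs)
  let σ : Γ → (M →+* M) := fun γ =>
    ((ρ γ : Ω →+* Ω).comp (algebraMap M Ω)).codRestrict M (fun a => hst γ a a.2)
  obtain ⟨v, hv, hSv⟩ := aux_descent' ρ σ
    (fun γ δ h => hinj γ δ (fun a ha => congrArg Subtype.val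
      (DFunLike.congr_fun h (⟨a, hTM a ha⟩ : M)))) (fun γ a => rfl) S hS (fun γ a ha => by
      have hle : Submodule.span K (S ∪ T) ≤
          (Submodule.span M (insert 1 S)).restrictScalars K := by
        rw [Submodule.span_le]
        rintro y (hy | hy)
        · exact Submodule.subset_span (Set.mem_insert_of_mem _ hy)
        · have : y = (⟨y, hTM y hy⟩ : M) • (1 : Ω) := by
            rw [Algebra.smul_def, mul_one]; rfl
          rw [this]
          exact Submodule.smul_mem (Submodule.span M (insert 1 S)) _
            (Submodule.subset_span (Set.mem_insert _ _))
      exact hle (hA γ a ha)) m hm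
  refine ⟨v, hv, fun L h0 h1 h2 s hs => ?_⟩
  exact adjoin_mem (F := M) (Set.range v) L (fun c : M => adjoin_mem T L h0 h1 (c : Ω) c.2)
    (by rintro _ ⟨i, rfl⟩; exact h2 i) s (hSv hs)


lemma s_abs {K E Z Ω : Type*} [Field K] [Field E] [Field Z] [Field Ω] [Algebra K E] [Algebra E Z]
    [FiniteDimensional E Z] [Algebra K Ω] [Algebra E Ω] [IsScalarTower K E Ω] (φz : Z →+* Ω)
    (hφ : ∀ a, algebraMap E Ω a = φz (algebraMap E Z a)) {r n : ℕ} (a b : ℕ)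
    (hE : Algebra.trdeg K E = a) (hΩ : Algebra.trdeg K Ω = b) {τ : Type*} [Finite τ]
    (t : Fin r → Ω) (x : τ → Ω) (hc : a + (r + Nat.card τ) ≤ b)
    (hgen : ∀ L : Subfield Ω, (∀ c, φz c ∈ L) → (∀ i, t i ∈ L) → (∀ i, x i ∈ L) → ∀ y, y ∈ L)
    (e : FractionRing (MvPolynomial (Fin r) E) ≃ₐ[K] FractionRing (MvPolynomial (Fin n) K)) :
    ∃ s : Fin n → Ω, n ≤ a + r ∧
      (∀ L : Subfield Ω, (∀ c : E, algebraMap E Ω c ∈ L) → (∀ i, t i ∈ L) → ∀ i, s i ∈ L) ∧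
      (∀ L : Subfield Ω, (∀ c : K, algebraMap K Ω c ∈ L) → (∀ i, s i ∈ L) →
        (∀ c : E, algebraMap E Ω c ∈ L) ∧ ∀ i, t i ∈ L) := by
  have hn : n ≤ a + r := by
    have h := lift_trdeg_add_eq K E (FractionRing (MvPolynomial (Fin r) E))
    have h2 := e.lift_trdeg_eq
    rw [frac_trdeg] at h2
    rw [frac_trdeg, hE] at h
    have h3 := congrArg Cardinal.toNat h
    have h4 := congrArg Cardinal.toNat h2
    simp only [Cardinal.toNat_lift, Nat.card_eq_fintype_card, Fintype.card_fin,
      Cardinal.toNat_natCast, Cardinal.lift_natCast, ← Nat.cast_add] at h3 h4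
    omega
  have hind : AlgebraicIndependent E (Sum.elim t x) := by
    refine aux_algInd (K := K) (Sum.elim t x) a b hE hΩ ?_ (by simpa [Nat.card_sum] using hc)
    set Q := IntermediateField.adjoin E (Set.range (Sum.elim t x)) with hQ
    have htop : IntermediateField.adjoin Q (Set.range φz) = ⊤ := by
      rw [eq_top_iff]
      intro y _
      have hm : ∀ i, Sum.elim t x i ∈ IntermediateField.adjoin Q (Set.range φz) := fun i =>
        IntermediateField.algebraMap_mem _
          (⟨_, IntermediateField.subset_adjoin _ _ ⟨i, rfl⟩⟩ : Q)
      exact hgen (IntermediateField.adjoin Q (Set.range φz)).toSubfield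
        (fun c => IntermediateField.subset_adjoin Q _ ⟨c, rfl⟩) (fun i => hm (.inl i))
        (fun i => hm (.inr i)) y
    exact alg_of_rank _ (rank_of_top _ htop _ (aux_rank (F := E) φz _ rfl
      (fun c => ⟨algebraMap E Q c, hφ c⟩)))
  obtain ⟨j, hj⟩ := exists_frac_lift t (hind.comp Sum.inl Sum.inl_injective)
  refine ⟨fun i => j (e.symm (xv K i)), hn, fun L h1 h2 i => ?_, fun L h1 h2 => ?_⟩
  · refine frac_mem (j : FractionRing (MvPolynomial (Fin r) E) →+* Ω) L (fun c => ?_) (fun i => ?_) _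
    · have := h1 c
      rwa [← j.commutes c] at this
    · have := h2 i
      rwa [← hj i] at this
  · have key : ∀ d, j d ∈ L := by
      intro d
      have := frac_mem ((j : FractionRing (MvPolynomial (Fin r) E) →+* Ω).comp
        (e.symm : FractionRing (MvPolynomial (Fin n) K) →+* FractionRing (MvPolynomial (Fin r) E))) L
        (fun c => ?_) h2 (e d)
      · simpa using this
      · have h := h1 c
        have h5 : e.symm (algebraMap K _ c) = algebraMap E _ (algebraMap K E c) := by
          rw [AlgEquiv.commutes, ← IsScalarTower.algebraMap_apply]
        have h6 := j.commutes (algebraMap K E c)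
        rw [← h5, ← IsScalarTower.algebraMap_apply] at h6
        rw [← h6] at h
        exact h
    exact ⟨fun c => by rw [← j.commutes c]; exact key _, fun i => by rw [← hj i]; exact key _⟩

theorem main_abs (K : Type*) [Field K] (H G : Type*) [Group H] [Group G] [Finite H] [Finite G]
    (r n : ℕ)
    (e : FractionRing (MvPolynomial (Fin r) (NoetherField K H)) ≃ₐ[K]
      FractionRing (MvPolynomial (Fin n) K))
    (ψ : NoetherBigField K G →ₐ[K] NoetherBigField K (H × G))
    (ι : NoetherField K G →ₐ[K] NoetherField K (H × G))
    (hψ : ∀ g, ψ (xv K g) = ∑ᶠ h : H, xv K (h, g))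
    (hι : ∀ a, noetherIncl K (H × G) (ι a) = ψ (noetherIncl K G a))
    (Ω : Type*) [Field Ω] [Algebra K Ω] (ρ : H × G →* (Ω ≃ₐ[K] Ω))
    (ξ : (H × G) ⊕ (H ⊕ Fin r) → Ω) (hξ : AlgebraicIndependent K ξ)
    (hgen : IntermediateField.adjoin K (Set.range ξ) = ⊤)
    (hρx : ∀ γ δ, ρ γ (ξ (.inl δ)) = ξ (.inl (γ * δ)))
    (hρz : ∀ γ h, ρ γ (ξ (.inr (.inl h))) = ξ (.inr (.inl (γ.1 * h))))
    (hρt : ∀ γ i, ρ γ (ξ (.inr (.inr i))) = ξ (.inr (.inr i))) :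
    @IsStablyRationalExtension (NoetherField K G) (NoetherField K (H × G)) _ _
        ι.toRingHom.toAlgebra := by
  classical
  haveI := Fintype.ofFinite H
  haveI := Fintype.ofFinite G
  simp only [finsum_eq_sum_of_fintype] at hψ
  obtain ⟨φx, hφx⟩ := exists_frac_lift (fun δ => ξ (.inl δ)) (hξ.comp _ Sum.inl_injective)
  obtain ⟨φz, hφz⟩ := exists_frac_lift (fun h : H => ξ (.inr (.inl h)))
    (hξ.comp (fun h => .inr (.inl h)) (Sum.inr_injective.comp Sum.inl_injective))
  let φy : NoetherBigField K G →ₐ[K] Ω := φx.comp ψ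
  have hφy : ∀ g, φy (xv K g) = ∑ h : H, ξ (.inl (h, g)) := by
    intro g
    simp only [φy, AlgHom.comp_apply, hψ, map_sum, hφx]
  have eqx : ∀ γ b, ρ γ (φx b) = φx (noetherAut K (H × G) γ b) := by
    intro γ b
    have := frac_ext ((ρ γ : Ω →+* Ω).comp (φx : NoetherBigField K (H × G) →+* Ω))
      ((φx : NoetherBigField K (H × G) →+* Ω).comp (noetherAut K (H × G) γ :
        NoetherBigField K (H × G) →+* NoetherBigField K (H × G))) (fun c => by simp)
        (fun i => by simp [noetherAut_xv, hφx, hρx])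
    exact DFunLike.congr_fun this b
  have eqz : ∀ γ b, ρ γ (φz b) = φz (noetherAut K H γ.1 b) := by
    intro γ b
    have := frac_ext ((ρ γ : Ω →+* Ω).comp (φz : NoetherBigField K H →+* Ω))
      ((φz : NoetherBigField K H →+* Ω).comp (noetherAut K H γ.1 :
        NoetherBigField K H →+* NoetherBigField K H)) (fun c => by simp)
        (fun i => by simp [noetherAut_xv, hφz, hρz])
    exact DFunLike.congr_fun this b
  have eqy : ∀ γ b, ρ γ (φy b) = φy (noetherAut K G γ.2 b) := by
    intro γ b
    have := frac_ext ((ρ γ : Ω →+* Ω).comp (φy : NoetherBigField K G →+* Ω))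
      ((φy : NoetherBigField K G →+* Ω).comp (noetherAut K G γ.2 :
        NoetherBigField K G →+* NoetherBigField K G)) (fun c => by simp)
        (fun i => by
          simp only [RingHom.comp_apply, RingHom.coe_coe, noetherAut_xv, hφy, map_sum, hρx]
          exact Fintype.sum_equiv (Equiv.mulLeft γ.1) _ _ (fun h => rfl))
    exact DFunLike.congr_fun this b
  have hρ : Function.Injective ρ := by
    intro γ δ h
    have := DFunLike.congr_fun h (ξ (.inl 1))
    rw [hρx, hρx] at this
    simpa using hξ.injective this
  have hN : Algebra.trdeg K Ω = (Nat.card H * Nat.card G + (Nat.card H + r) : ℕ) := by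
    rw [trdeg_of_gen ξ hξ hgen]
    simp [Nat.card_sum, Nat.card_prod]
  have hΩtop : ∀ L : Subfield Ω, (∀ c, algebraMap K Ω c ∈ L) → (∀ δ, ξ (.inl δ) ∈ L) →
      (∀ h, ξ (.inr (.inl h)) ∈ L) → (∀ i, ξ (.inr (.inr i)) ∈ L) → ∀ a, a ∈ L := by
    intro L h0 h1 h2 h3 a
    refine adjoin_mem (Set.range ξ) L h0 ?_ a (by rw [hgen]; trivial)
    rintro _ ⟨(δ | h | i), rfl⟩
    exacts [h1 δ, h2 h, h3 i]
  have hcard : Nat.card (H × G) = Nat.card H * Nat.card G := Nat.card_prod _ _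
  -- algebra structures
  letI aBΩ : Algebra (NoetherBigField K (H × G)) Ω := φx.toRingHom.toAlgebra
  letI aPΩ : Algebra (NoetherField K (H × G)) Ω := (φx.comp (noetherIncl K (H × G))).toRingHom.toAlgebra
  letI akP : Algebra (NoetherField K G) (NoetherField K (H × G)) := ι.toRingHom.toAlgebra
  letI akΩ : Algebra (NoetherField K G) Ω := (φy.comp (noetherIncl K G)).toRingHom.toAlgebra
  letI aEΩ : Algebra (NoetherField K H) Ω := (φz.comp (noetherIncl K H)).toRingHom.toAlgebra
  haveI : IsScalarTower (NoetherField K G) (NoetherField K (H × G)) Ω :=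
    IsScalarTower.of_algebraMap_eq fun a => (congrArg φx (hι a)).symm
  haveI : IsScalarTower K (NoetherField K (H × G)) Ω :=
    IsScalarTower.of_algebraMap_eq fun a =>
      ((φx.comp (noetherIncl K (H × G))).commutes a).symm
  haveI : IsScalarTower K (NoetherField K G) Ω :=
    IsScalarTower.of_algebraMap_eq fun a => ((φy.comp (noetherIncl K G)).commutes a).symm
  haveI : IsScalarTower K (NoetherField K H) Ω :=
    IsScalarTower.of_algebraMap_eq fun a => ((φz.comp (noetherIncl K H)).commutes a).symm
  haveI : IsScalarTower (NoetherField K (H × G)) (NoetherBigField K (H × G)) Ω :=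
    IsScalarTower.of_algebraMap_eq fun a => rfl
  haveI := (noether_fin K (H × G)).1
  haveI := (noether_fin K H).1
  haveI := (noether_fin K G).1
  have hPfix : ∀ γ p, ρ γ (algebraMap (NoetherField K (H × G)) Ω p) =
      algebraMap (NoetherField K (H × G)) Ω p := fun γ p =>
    (eqx γ _).trans (congrArg φx (noetherIncl_fixed K (H × G) p γ))
  have hkfix : ∀ γ p, ρ γ (algebraMap (NoetherField K G) Ω p) =
      algebraMap (NoetherField K G) Ω p := fun γ p =>
    (eqy γ _).trans (congrArg φy (noetherIncl_fixed K G p γ.2))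
  have hEfix : ∀ γ p, ρ γ (algebraMap (NoetherField K H) Ω p) =
      algebraMap (NoetherField K H) Ω p := fun γ p =>
    (eqz γ _).trans (congrArg φz (noetherIncl_fixed K H p γ.1))
  -- part I
  obtain ⟨u, hu1, hu2⟩ := partI_abs (P := NoetherField K (H × G)) (B := NoetherBigField K (H × G))
    (noether_fin K (H × G)).2 ρ hρ hPfix
    (fun γ => (noetherAut K (H × G) γ : NoetherBigField K (H × G) →+* NoetherBigField K (H × G)))
    (fun a b h => noetherAut_inj K (H × G) (AlgEquiv.ext fun x => DFunLike.congr_fun h x))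
    (fun γ m => (eqx γ m).symm)
    (Set.range (fun i : H ⊕ Fin r => ξ (.inr i))) (Set.finite_range _)
    (by
      rintro γ _ ⟨(h | i), rfl⟩
      · simp only [hρz]
        exact ⟨_, rfl⟩
      · simp only [hρt]
        exact ⟨_, rfl⟩)
    (Nat.card H + r)
    (by
      rw [← Set.image_univ]
      refine (Set.ncard_image_le Set.finite_univ).trans ?_
      rw [Set.ncard_univ, Nat.card_sum]; simp)
    _ _ (noether_trdeg K (H × G)) hN (by rw [hcard])
    (fun L h1 h2 => hΩtop L (fun c => by rw [← φx.commutes c]; exact h1 _)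
      (fun δ => by rw [← hφx]; exact h1 _) (fun h => h2 _ ⟨.inl h, rfl⟩)
      (fun i => h2 _ ⟨.inr i, rfl⟩))
  -- part II
  obtain ⟨s, hn, hs1, hs2⟩ := s_abs (E := NoetherField K H) (Z := NoetherBigField K H)
    (φz : NoetherBigField K H →+* Ω) (fun a => rfl) _ _ (noether_trdeg K H) hN
    (fun i => ξ (.inr (.inr i))) (fun δ => ξ (.inl δ)) (by rw [hcard]; omega)
    (fun L h1 h2 h3 => hΩtop L (fun c => by rw [← φz.commutes c]; exact h1 _) h3
      (fun h => by rw [← hφz]; exact h1 _) h2) e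
  have hsfix : ∀ i γ, ρ γ (s i) = s i := fun i =>
    hs1 (fixedSub ρ) (fun c γ => hEfix γ c) (fun i γ => hρt γ i) i
  obtain ⟨v, hv1, hv2⟩ := descent_sub ρ
    (Set.range (fun g => φy (xv K g)) ∪ (Set.range (fun h => φz (xv K h))))
    (by
      rintro γ _ (⟨g, rfl⟩ | ⟨h, rfl⟩)
      · exact .inl ⟨γ.2 * g, by simp only [eqy, noetherAut_xv]⟩
      · exact .inr ⟨γ.1 * h, by simp only [eqz, noetherAut_xv]⟩)
    (by
      intro γ δ h
      have h1 := h _ (.inl ⟨1, rfl⟩)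
      have h2 := h _ (.inr ⟨1, rfl⟩)
      simp only [eqy, eqz, noetherAut_xv] at h1 h2
      have h3 := (xv_algInd K G).injective (φy.toRingHom.injective h1)
      have h4 := (xv_algInd K H).injective (φz.toRingHom.injective h2)
      simp only [mul_one] at h3 h4
      exact Prod.ext h4 h3)
    (Set.range (fun p : {h : H // h ≠ 1} × G => ξ (.inl (p.1.1, p.2)))) (Set.finite_range _)
    (by
      rintro γ _ ⟨⟨⟨h, hh⟩, g⟩, rfl⟩
      simp only [hρx]
      by_cases h1 : γ.1 * h = 1
      · have h2 : ξ (.inl (γ * (h, g))) = φy (xv K (γ.2 * g)) -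
            ∑ h ∈ Finset.univ.erase (1 : H), ξ (.inl (h, γ.2 * g)) := by
          rw [hφy, ← Finset.add_sum_erase _ _ (Finset.mem_univ (1 : H)), add_sub_cancel_right, ← h1]
          rfl
        rw [h2]
        refine Submodule.sub_mem _ (Submodule.subset_span (.inr (.inl ⟨_, rfl⟩)))
          (Submodule.sum_mem _ fun h hh => Submodule.subset_span (.inl ?_))
        exact ⟨⟨⟨h, Finset.ne_of_mem_erase hh⟩, γ.2 * g⟩, rfl⟩
      · exact Submodule.subset_span (.inl ⟨⟨⟨γ.1 * h, h1⟩, γ.2 * g⟩, rfl⟩))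
    ((Nat.card H - 1) * Nat.card G)
    (by
      rw [← Set.image_univ]
      refine (Set.ncard_image_le Set.finite_univ).trans ?_
      rw [Set.ncard_univ, Nat.card_prod]
      refine Nat.mul_le_mul_right _ ?_
      rw [Nat.card_eq_fintype_card, Nat.card_eq_fintype_card, Fintype.card_subtype_compl]
      simp)
  let w : Fin (n + (Nat.card H - 1) * Nat.card G) → Ω := fun i => Sum.elim s v (finSumFinEquiv.symm i)
  have hws : ∀ i, w (finSumFinEquiv (.inl i)) = s i := fun i => by simp only [w, Equiv.symm_apply_apply, Sum.elim_inl]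
  have hwv : ∀ i, w (finSumFinEquiv (.inr i)) = v i := fun i => by simp only [w, Equiv.symm_apply_apply, Sum.elim_inr]
  have hwfix : ∀ i γ, ρ γ (w i) = w i := by
    intro i γ
    simp only [w]
    rcases finSumFinEquiv.symm i with i | i
    · exact hsfix i γ
    · exact hv1 i γ
  have hcount : Nat.card G + (n + (Nat.card H - 1) * Nat.card G) ≤
      Nat.card H * Nat.card G + (Nat.card H + r) := by
    obtain ⟨c, hc⟩ : ∃ c, Nat.card H = c + 1 := Nat.exists_eq_succ_of_ne_zero Nat.card_pos.ne'
    rw [hc] at hn ⊢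
    simp only [Nat.add_sub_cancel]
    nlinarith
  have hw := partII_abs (k := NoetherField K G) (Y := NoetherBigField K G) (E := NoetherField K H)
    (Z := NoetherBigField K H)
    (by rw [(noether_fin K G).2, (noether_fin K H).2, hcard, mul_comm])
    (φy : NoetherBigField K G →+* Ω) (φz : NoetherBigField K H →+* Ω) (fun a => rfl) ρ hρ hkfix
    w hwfix
    (fun a => (hs2 (IntermediateField.adjoin K (Set.range w)).toSubfield
      (fun c => IntermediateField.algebraMap_mem _ c)
      (fun i => by
        rw [← hws i]; exact IntermediateField.subset_adjoin K _ ⟨_, rfl⟩)).1 a)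
    _ _ (noether_trdeg K G) hN hcount
    (by
      intro L hy hz hwL
      have hK : ∀ c, algebraMap K Ω c ∈ L := fun c => by rw [← φz.commutes c]; exact hz _
      have ht := (hs2 L hK (fun i => by rw [← hws i]; exact hwL _)).2
      have hS := hv2 L hK (by
        rintro _ (⟨g, rfl⟩ | ⟨h, rfl⟩)
        exacts [hy _, hz _]) (fun i => by rw [← hwv i]; exact hwL _)
      have hx1 : ∀ h : H, h ≠ 1 → ∀ g, ξ (.inl (h, g)) ∈ L := fun h hh g =>
        hS _ ⟨⟨⟨h, hh⟩, g⟩, rfl⟩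
      refine hΩtop L hK (fun δ => ?_) (fun h => by rw [← hφz]; exact hz _) ht
      obtain ⟨h, g⟩ := δ
      by_cases hh : h = 1
      · have h2 : ξ (.inl (h, g)) = φy (xv K g) -
            ∑ h ∈ Finset.univ.erase (1 : H), ξ (.inl (h, g)) := by
          rw [hφy, ← Finset.add_sum_erase _ _ (Finset.mem_univ (1 : H)), add_sub_cancel_right, hh]
        rw [h2]
        exact L.sub_mem (hy _) (L.sum_mem fun h hh => hx1 h (Finset.ne_of_mem_erase hh) g)
      · exact hx1 h hh g)
  exact aux_final u w hu1 hw.1 (hu2.trans hw.2.symm)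


lemma exists_psi (K : Type*) [Field K] (H G : Type*) [Group H] [Group G] [Finite H] [Finite G] :
    ∃ ψ : NoetherBigField K G →ₐ[K] NoetherBigField K (H × G),
      ∀ g, ψ (xv K g) = ∑ᶠ h : H, xv K (h, g) := by
  classical
  have := Fintype.ofFinite H
  simp only [finsum_eq_sum_of_fintype]
  refine exists_frac_lift (fun g => ∑ h : H, xv K (h, g)) ?_
  have h1 : AlgebraicIndependent K
      (fun g : G => ∑ h : H, (MvPolynomial.X (h, g) : MvPolynomial (H × G) K)) := by
    refine AlgebraicIndependent.of_comp (MvPolynomial.aeval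
      (fun p : H × G => if p.1 = 1 then (MvPolynomial.X p.2 : MvPolynomial G K) else 0)) ?_
    convert MvPolynomial.algebraicIndependent_X G K using 1
    funext g
    simp
  have h2 := h1.map' (f := IsScalarTower.toAlgHom K (MvPolynomial (H × G) K)
    (NoetherBigField K (H × G))) (IsFractionRing.injective _ _)
  have h3 : (fun g : G => ∑ h : H, (xv K (h, g) : NoetherBigField K (H × G))) =
      (IsScalarTower.toAlgHom K (MvPolynomial (H × G) K) (NoetherBigField K (H × G))) ∘
        (fun g : G => ∑ h : H, (MvPolynomial.X (h, g) : MvPolynomial (H × G) K)) := by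
    funext g
    simp [xv]
  rw [h3]
  exact h2

lemma exists_iota (K : Type*) [Field K] (H G : Type*) [Group H] [Group G] [Finite H] [Finite G]
    (ψ : NoetherBigField K G →ₐ[K] NoetherBigField K (H × G))
    (hψ : ∀ g, ψ (xv K g) = ∑ᶠ h : H, xv K (h, g)) :
    ∃ ι : NoetherField K G →ₐ[K] NoetherField K (H × G),
      ∀ a, noetherIncl K (H × G) (ι a) = ψ (noetherIncl K G a) := by
  have := Fintype.ofFinite H
  simp only [finsum_eq_sum_of_fintype] at hψ
  have eqv : ∀ γ b, noetherAut K (H × G) γ (ψ b) = ψ (noetherAut K G γ.2 b) := by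
    intro γ b
    have := frac_ext ((noetherAut K (H × G) γ :
        NoetherBigField K (H × G) →+* NoetherBigField K (H × G)).comp
        (ψ : NoetherBigField K G →+* NoetherBigField K (H × G)))
      ((ψ : NoetherBigField K G →+* NoetherBigField K (H × G)).comp (noetherAut K G γ.2 :
        NoetherBigField K G →+* NoetherBigField K G)) (fun c => by simp)
        (fun i => by
          simp only [RingHom.comp_apply, RingHom.coe_coe, noetherAut_xv, hψ, map_sum]
          exact Fintype.sum_equiv (Equiv.mulLeft γ.1) _ _ (fun h => rfl))
    exact DFunLike.congr_fun this b
  have hex : ∀ a, ∃ b, noetherIncl K (H × G) b = ψ (noetherIncl K G a) := fun a =>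
    noetherIncl_surj K (H × G) _ (fun γ => by rw [eqv, noetherIncl_fixed])
  choose f hf using hex
  have hi := noetherIncl_inj K (H × G)
  exact ⟨{ toFun := f
           map_one' := hi (by rw [hf]; simp only [map_one])
           map_mul' := fun a b => hi (by rw [hf]; simp only [map_mul, hf])
           map_zero' := hi (by rw [hf]; simp only [map_zero])
           map_add' := fun a b => hi (by rw [hf]; simp only [map_add, hf])
           commutes' := fun c => hi (by rw [hf]; simp only [AlgHom.commutes]) }, hf⟩

/-- permutation of variables -/
def permAut (K : Type*) [Field K] {σ : Type*} (p : Equiv.Perm σ) :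
    FractionRing (MvPolynomial σ K) ≃ₐ[K] FractionRing (MvPolynomial σ K) :=
  IsFractionRing.algEquivOfAlgEquiv (MvPolynomial.renameEquiv K p)

lemma permAut_xv (K : Type*) [Field K] {σ : Type*} (p : Equiv.Perm σ) (i : σ) :
    permAut K p (xv K i) = xv K (p i) := by
  simp [permAut, xv]

lemma permAut_mul (K : Type*) [Field K] {σ : Type*} (p q : Equiv.Perm σ) :
    permAut K (p * q) = permAut K p * permAut K q := by
  have := frac_ext (permAut K (p * q) : FractionRing (MvPolynomial σ K) →+* FractionRing (MvPolynomial σ K))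
    ((permAut K p * permAut K q : FractionRing (MvPolynomial σ K) ≃ₐ[K] FractionRing (MvPolynomial σ K)) :
      FractionRing (MvPolynomial σ K) →+* FractionRing (MvPolynomial σ K)) (fun c => ?_) (fun i => ?_)
  · ext a
    exact DFunLike.congr_fun this a
  · simp
  · simp [permAut_xv]

lemma main_one (K : Type*) [Field K] (H G : Type*) [Group H] [Group G] [Finite H] [Finite G]
    (hH : IsStablyRationalExtension K (NoetherField K H)) :
    ∃ ι : NoetherField K G →ₐ[K] NoetherField K (H × G),
      @IsStablyRationalExtension (NoetherField K G) (NoetherField K (H × G)) _ _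
        ι.toRingHom.toAlgebra := by
  obtain ⟨r, n, ⟨e⟩⟩ := hH
  obtain ⟨ψ, hψ⟩ := exists_psi K H G
  obtain ⟨ι, hι⟩ := exists_iota K H G ψ hψ
  let π : H × G → Equiv.Perm ((H × G) ⊕ (H ⊕ Fin r)) := fun γ =>
    Equiv.sumCongr (Equiv.mulLeft γ) (Equiv.sumCongr (Equiv.mulLeft γ.1) (Equiv.refl _))
  have hπ : ∀ γ δ, π (γ * δ) = π γ * π δ := by
    intro γ δ
    ext (a | a | a)
    · simp [π, mul_assoc]
    · simp [π, mul_assoc]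
    · simp [π]
  let ρ := MonoidHom.mk' (fun γ => permAut K (π γ))
    (fun γ δ => by rw [hπ, permAut_mul])
  refine ⟨ι, main_abs K H G r n e ψ ι hψ hι _ ρ (xv K) (xv_algInd _ _) (xv_adjoin _ _) ?_ ?_ ?_⟩
  · intro γ δ; exact permAut_xv _ _ _
  · intro γ δ; exact permAut_xv _ _ _
  · intro γ δ; exact permAut_xv _ _ _


lemma tower_gen {F W Ω σ τ : Type*} [Field F] [Field W] [Field Ω] [Algebra F W] [Algebra W Ω]
    [Algebra F Ω] [IsScalarTower F W Ω] (u : σ → W) (hu : AlgebraicIndependent F u)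
    (hug : IntermediateField.adjoin F (Set.range u) = ⊤) (t : τ → Ω)
    (ht : AlgebraicIndependent W t) (htg : IntermediateField.adjoin W (Set.range t) = ⊤) :
    AlgebraicIndependent F (Sum.elim t (algebraMap W Ω ∘ u)) ∧
    IntermediateField.adjoin F (Set.range (Sum.elim t (algebraMap W Ω ∘ u))) = ⊤ := by
  refine ⟨hu.sumElim_comp ht, ?_⟩
  rw [eq_top_iff]
  intro x _
  set L := IntermediateField.adjoin F (Set.range (Sum.elim t (algebraMap W Ω ∘ u))) with hL
  have hm : ∀ i, Sum.elim t (algebraMap W Ω ∘ u) i ∈ L := fun i =>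
    IntermediateField.subset_adjoin F _ ⟨i, rfl⟩
  refine adjoin_mem (F := W) (Set.range t) L.toSubfield (fun c => ?_) ?_ x (by rw [htg]; trivial)
  · refine adjoin_mem (F := F) (Set.range u) (L.toSubfield.comap (algebraMap W Ω)) (fun c => ?_) ?_ c
      (by rw [hug]; trivial)
    · change algebraMap W Ω _ ∈ L
      rw [← IsScalarTower.algebraMap_apply]
      exact L.algebraMap_mem c
    · rintro _ ⟨i, rfl⟩
      exact hm (.inr i)
  · rintro _ ⟨i, rfl⟩
    exact hm (.inl i)

lemma reindex_gen {F Ω : Type*} [Field F] [Field Ω] [Algebra F Ω] {a b : ℕ}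
    (x : Fin a ⊕ Fin b → Ω) (hx : AlgebraicIndependent F x)
    (hg : IntermediateField.adjoin F (Set.range x) = ⊤) :
    ∃ y : Fin (a + b) → Ω, AlgebraicIndependent F y ∧
      IntermediateField.adjoin F (Set.range y) = ⊤ :=
  ⟨x ∘ finSumFinEquiv.symm, hx.comp _ finSumFinEquiv.symm.injective, by
    rw [EquivLike.range_comp]; exact hg⟩

lemma trans_abs {K k P Ω : Type*} [Field K] [Field k] [Field P] [Field Ω] [Algebra K k]
    [Algebra K P] [Algebra P Ω] [Algebra k Ω] [Algebra K Ω]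
    [IsScalarTower K k Ω] [IsScalarTower K P Ω] {m r n q : ℕ} (a : ℕ)
    (ha : Algebra.trdeg K k = a)
    (u : Fin m → Ω) (hu : AlgebraicIndependent P u)
    (hug : IntermediateField.adjoin P (Set.range u) = ⊤)
    (t : Fin r → Ω) (w : Fin n → Ω) (hw : AlgebraicIndependent k (Sum.elim t w))
    (hwg : IntermediateField.adjoin k (Set.range (Sum.elim t w)) = ⊤)
    (e : FractionRing (MvPolynomial (Fin r) k) ≃ₐ[K] FractionRing (MvPolynomial (Fin q) K)) :
    IsStablyRationalExtension K P := by
  have hΩ : Algebra.trdeg K Ω = (a + (r + n) : ℕ) := by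
    have h := lift_trdeg_add_eq K k Ω
    rw [trdeg_of_gen _ hw hwg, ha] at h
    simp only [Cardinal.lift_natCast, Nat.card_sum, Nat.card_fin, ← Nat.cast_add] at h
    symm at h
    rwa [Cardinal.lift_eq_nat_iff] at h
  have hgen : ∀ L : Subfield Ω, (∀ c, algebraMap k Ω c ∈ L) → (∀ i, t i ∈ L) → (∀ i, w i ∈ L) →
      ∀ y, y ∈ L := by
    intro L h1 h2 h3 y
    refine adjoin_mem _ L h1 ?_ y (by rw [hwg]; trivial)
    rintro _ ⟨(i | i), rfl⟩
    exacts [h2 i, h3 i]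
  obtain ⟨s, hq, -, hs⟩ := s_abs (E := k) (Z := k) (algebraMap k Ω) (fun _ => rfl) a _ ha hΩ t w
    (by simp) hgen e
  have htop : IntermediateField.adjoin K (Set.range (Sum.elim s w)) = ⊤ := by
    rw [eq_top_iff]
    intro y _
    have hm : ∀ i, Sum.elim s w i ∈ IntermediateField.adjoin K (Set.range (Sum.elim s w)) :=
      fun i => IntermediateField.subset_adjoin K _ ⟨i, rfl⟩
    obtain ⟨h1, h2⟩ := hs (IntermediateField.adjoin K (Set.range (Sum.elim s w))).toSubfield
      (fun c => IntermediateField.algebraMap_mem _ c) (fun i => hm (.inl i))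
    exact hgen _ h1 h2 (fun i => hm (.inr i)) y
  have hind : AlgebraicIndependent K (Sum.elim s w) := by
    refine aux_algInd (K := K) _ 0 _ (by rw [trdeg_eq_zero]; simp) hΩ ?_ ?_
    · rw [htop]
      exact ⟨fun a => isAlgebraic_algebraMap (A := Ω) (⟨a, trivial⟩ : (⊤ : IntermediateField K Ω))⟩
    · simp only [Nat.card_sum, Nat.card_fin]; omega
  obtain ⟨y, hy, hyg⟩ := reindex_gen _ hind htop
  refine aux_final u y hu hy ?_
  rw [hug, hyg]; rfl

lemma stab_trans {K k P : Type*} [Field K] [Field k] [Field P] [Algebra K k]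
    [Algebra K P] [Algebra k P] [IsScalarTower K k P] (a : ℕ) (ha : Algebra.trdeg K k = a)
    (h1 : IsStablyRationalExtension K k) (h2 : IsStablyRationalExtension k P) :
    IsStablyRationalExtension K P := by
  obtain ⟨r, q, ⟨e⟩⟩ := h1
  obtain ⟨m, n, ⟨f⟩⟩ := h2
  let W := FractionRing (MvPolynomial (Fin m) P)
  let Ω := FractionRing (MvPolynomial (Fin r) W)
  let w : Fin n → W := fun i => f.symm (xv k i)
  have hw : AlgebraicIndependent k w :=
    (xv_algInd k (Fin n)).map' (f := f.symm.toAlgHom) f.symm.injective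
  have hwg : IntermediateField.adjoin k (Set.range w) = ⊤ := by
    rw [eq_top_iff]
    intro x _
    have := frac_mem (f.symm : FractionRing (MvPolynomial (Fin n) k) →+* W)
      (IntermediateField.adjoin k (Set.range w)).toSubfield (fun c => by
        have : f.symm (algebraMap k _ c) = algebraMap k W c := f.symm.commutes c
        simp only [RingHom.coe_coe, this]
        exact IntermediateField.algebraMap_mem _ c)
      (fun i => IntermediateField.subset_adjoin k _ ⟨i, rfl⟩) (f x)
    rwa [RingHom.coe_coe, f.symm_apply_apply] at this
  obtain ⟨h3, h4⟩ := tower_gen (F := k) (W := W) (Ω := Ω) w hw hwg (xv W)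
    (xv_algInd W (Fin r)) (xv_adjoin W (Fin r))
  obtain ⟨h5, h6⟩ := tower_gen (F := P) (W := W) (Ω := Ω) (xv P) (xv_algInd P (Fin m))
    (xv_adjoin P (Fin m)) (xv W)
    (xv_algInd W (Fin r)) (xv_adjoin W (Fin r))
  obtain ⟨u, hu, hug⟩ := reindex_gen _ h5 h6
  exact trans_abs a ha u hu hug _ _ h3 h4 e

lemma main_two (K : Type*) [Field K] (H G : Type*) [Group H] [Group G] [Finite H] [Finite G]
    (ι : NoetherField K G →ₐ[K] NoetherField K (H × G))
    (h : @IsStablyRationalExtension (NoetherField K G) (NoetherField K (H × G)) _ _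
        ι.toRingHom.toAlgebra) (hG : IsStablyRationalExtension K (NoetherField K G)) :
    IsStablyRationalExtension K (NoetherField K (H × G)) := by
  letI := ι.toRingHom.toAlgebra
  haveI : IsScalarTower K (NoetherField K G) (NoetherField K (H × G)) :=
    IsScalarTower.of_algebraMap_eq fun a => (ι.commutes a).symm
  exact stab_trans _ (noether_trdeg K G) hG h


end NoetherMain

/-- Theorem 1.9 (stably rational case): if `K(H)` is stably rational over `K`, then there is a
`K`-embedding of `K(G)` into `K(H × G)` making `K(H × G)` stably rational over (the image of)
`K(G)`; in particular, if both `K(H)` and `K(G)` are stably rational over `K`, so is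
`K(H × G)`. -/
theorem noether_stably_rational_direct_product
    (K : Type*) [Field K] (H G : Type*) [Group H] [Group G] [Finite H] [Finite G]
    (hH : IsStablyRationalExtension K (NoetherField K H)) :
    (∃ ι : NoetherField K G →ₐ[K] NoetherField K (H × G),
      @IsStablyRationalExtension (NoetherField K G) (NoetherField K (H × G)) _ _
        ι.toRingHom.toAlgebra) ∧
    (IsStablyRationalExtension K (NoetherField K G) →
      IsStablyRationalExtension K (NoetherField K (H × G))) := by
  obtain ⟨ι, hι⟩ := main_one K H G hH
  exact ⟨⟨ι, hι⟩, fun hG => main_two K H G ι hι hG⟩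

end
end
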